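/- arXiv:nlin/0312042 — 7 statements merged into one kernel-verified Lean document; each statement's English description precedes it below -/
import Mathlib

section
/- Fix any F̃ > 0 and K̃ > 0. Then there exists Γ₀ > 0 such that for all 0 < Γ ≤ Γ₀, all F ≥ F̃ and all 0 < K ≤ K̃, the discrete sine-Gordon ring admits a travelling wave; that is, there exist a velocity v > 0 and a waveform f satisfying the defining conditions of a travelling wave with these parameters. -/
open Real in
/-- `f` is the waveform of a travelling wave with velocity `v` of the discrete
sine-Gordon ring with `n` sites, winding number `m`, damping `Γ`, coupling `K`
and force `F`: `f` is `C²`, satisfies `f (t + T) = f t + 2π` with `T = 2π/v`,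
and the waveform equation. -/
def IsWaveform (n m : ℕ) (Γ K F v : ℝ) (f : ℝ → ℝ) : Prop :=
  ContDiff ℝ 2 f ∧
  (∀ t : ℝ, f (t + 2 * π / v) = f t + 2 * π) ∧
  (∀ t : ℝ, deriv (deriv f) t + Γ * deriv f t + Real.sin (f t)
      = F + K * (f (t + ((m : ℝ) / n) * (2 * π / v)) - 2 * f t
          + f (t - ((m : ℝ) / n) * (2 * π / v))))

open Real

/-- The mean of a `2π`-periodic function over one period. -/
noncomputable def periodMean (w : ℝ → ℝ) : ℝ := (2 * π)⁻¹ * ∫ x in (0 : ℝ)..(2 * π), w x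

/-- The primitive, vanishing at `0`, of `w` minus its mean. -/
noncomputable def centeredPrimitive (w : ℝ → ℝ) (x : ℝ) : ℝ :=
  ∫ y in (0 : ℝ)..x, (w y - periodMean w)

/-- The coupling and pendulum forces, in the comoving variable, for the waveform `x + u x`, where
`u` is the second centered primitive of `w`. -/
noncomputable def waveForce (K a : ℝ) (w : ℝ → ℝ) (x : ℝ) : ℝ :=
  K * (centeredPrimitive (centeredPrimitive w) (x + a)
      - 2 * centeredPrimitive (centeredPrimitive w) x
      + centeredPrimitive (centeredPrimitive w) (x - a))
    - sin (x + centeredPrimitive (centeredPrimitive w) x)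

/-- The map whose fixed points are the second derivatives of the periodic part of travelling
waves; here `ε = v⁻²` and `δ = Γ / v`. -/
noncomputable def waveMap (K a ε δ : ℝ) (w : ℝ → ℝ) (x : ℝ) : ℝ :=
  ε * (waveForce K a w x - periodMean (waveForce K a w))
    - δ * (centeredPrimitive w x - periodMean (centeredPrimitive w))

theorem periodMean_sub {f g : ℝ → ℝ} (hf : Continuous f) (hg : Continuous g) :
    periodMean (fun x => f x - g x) = periodMean f - periodMean g := by
  unfold periodMean
  rw [intervalIntegral.integral_sub (hf.intervalIntegrable _ _) (hg.intervalIntegrable _ _)]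
  ring

theorem periodMean_const_mul (c : ℝ) (f : ℝ → ℝ) :
    periodMean (fun x => c * f x) = c * periodMean f := by
  unfold periodMean
  rw [intervalIntegral.integral_const_mul]
  ring

theorem periodMean_const (c : ℝ) : periodMean (fun _ => c) = c := by
  unfold periodMean
  rw [intervalIntegral.integral_const]
  have := pi_ne_zero
  simp only [smul_eq_mul]
  field_simp
  ring

theorem abs_periodMean_sub_le {f g : ℝ → ℝ} (hf : Continuous f) (hg : Continuous g) {d : ℝ}
    (h : ∀ x, |f x - g x| ≤ d) : |periodMean f - periodMean g| ≤ d := by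
  rw [← periodMean_sub hf hg]
  unfold periodMean
  have hpi : 0 < 2 * π := by positivity
  have h1 : ‖∫ x in (0 : ℝ)..(2 * π), (f x - g x)‖ ≤ d * |2 * π - 0| :=
    intervalIntegral.norm_integral_le_of_norm_le_const fun x _ => h x
  rw [Real.norm_eq_abs, sub_zero, abs_of_pos hpi] at h1
  rw [abs_mul, abs_of_pos (inv_pos.2 hpi), inv_mul_le_iff₀ hpi]
  linarith

theorem hasDerivAt_centeredPrimitive {w : ℝ → ℝ} (hw : Continuous w) (x : ℝ) :
    HasDerivAt (centeredPrimitive w) (w x - periodMean w) x := by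
  have hc : Continuous fun y => w y - periodMean w := by fun_prop
  exact intervalIntegral.integral_hasDerivAt_right (hc.intervalIntegrable _ _)
    (hc.stronglyMeasurableAtFilter _ _) hc.continuousAt

theorem continuous_centeredPrimitive {w : ℝ → ℝ} (hw : Continuous w) :
    Continuous (centeredPrimitive w) :=
  continuous_iff_continuousAt.2 fun x => (hasDerivAt_centeredPrimitive hw x).continuousAt

theorem periodic_centeredPrimitive {w : ℝ → ℝ} (hw : Continuous w)
    (hp : Function.Periodic w (2 * π)) : Function.Periodic (centeredPrimitive w) (2 * π) := by
  intro x
  have hc : Continuous fun y => w y - periodMean w := by fun_prop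
  have hcp : Function.Periodic (fun y => w y - periodMean w) (2 * π) := fun y => by simp [hp y]
  have h0 : ∫ y in (0 : ℝ)..(2 * π), (w y - periodMean w) = 0 := by
    rw [intervalIntegral.integral_sub (hw.intervalIntegrable _ _) (by simp),
      intervalIntegral.integral_const]
    have := pi_ne_zero
    unfold periodMean
    simp only [smul_eq_mul]
    field_simp
    ring
  unfold centeredPrimitive
  rw [← intervalIntegral.integral_add_adjacent_intervals
    (hc.intervalIntegrable 0 x) (hc.intervalIntegrable x (x + 2 * π)),
    hcp.intervalIntegral_add_eq x 0, zero_add, h0, add_zero]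

theorem abs_centeredPrimitive_sub_le {f g : ℝ → ℝ} (hf : Continuous f) (hg : Continuous g)
    (hfp : Function.Periodic f (2 * π)) (hgp : Function.Periodic g (2 * π)) {d : ℝ}
    (h : ∀ x, |f x - g x| ≤ d) (x : ℝ) :
    |centeredPrimitive f x - centeredPrimitive g x| ≤ 4 * π * d := by
  have hpi : 0 < 2 * π := by positivity
  have hper : Function.Periodic (fun x => centeredPrimitive f x - centeredPrimitive g x) (2 * π) :=
    (periodic_centeredPrimitive hf hfp).sub (periodic_centeredPrimitive hg hgp)
  obtain ⟨y, ⟨hy0, hy1⟩, hxy⟩ := hper.exists_mem_Ico₀ hpi x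
  rw [hxy]
  unfold centeredPrimitive
  have hfc : Continuous fun z => f z - periodMean f := by fun_prop
  have hgc : Continuous fun z => g z - periodMean g := by fun_prop
  rw [← intervalIntegral.integral_sub (hfc.intervalIntegrable _ _) (hgc.intervalIntegrable _ _)]
  have hm := abs_periodMean_sub_le hf hg h
  have h1 := intervalIntegral.norm_integral_le_of_norm_le_const (a := 0) (b := y) (C := 2 * d)
    (f := fun z => f z - periodMean f - (g z - periodMean g)) fun z _ => by
      rw [Real.norm_eq_abs, abs_le]
      have := abs_le.1 (h z)
      have := abs_le.1 hm
      constructor <;> linarith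
  rw [Real.norm_eq_abs, sub_zero, abs_of_nonneg hy0] at h1
  have hd : 0 ≤ d := (abs_nonneg _).trans (h 0)
  nlinarith

theorem centeredPrimitive_zero : centeredPrimitive (fun _ => 0) = fun _ => 0 := by
  funext x
  simp [centeredPrimitive, periodMean_const]

theorem continuous_waveForce (K a : ℝ) {w : ℝ → ℝ} (hw : Continuous w) :
    Continuous (waveForce K a w) := by
  have := continuous_centeredPrimitive (continuous_centeredPrimitive hw)
  unfold waveForce
  fun_prop

theorem periodic_waveForce (K a : ℝ) {w : ℝ → ℝ} (hw : Continuous w)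
    (hp : Function.Periodic w (2 * π)) : Function.Periodic (waveForce K a w) (2 * π) := by
  intro x
  have hu := periodic_centeredPrimitive (continuous_centeredPrimitive hw)
    (periodic_centeredPrimitive hw hp)
  unfold waveForce
  rw [add_right_comm, add_sub_right_comm, hu, hu, hu, add_right_comm, sin_add_two_pi]

theorem abs_waveForce_sub_le {K : ℝ} (hK : 0 ≤ K) (a : ℝ) {f g : ℝ → ℝ} (hf : Continuous f)
    (hg : Continuous g) (hfp : Function.Periodic f (2 * π)) (hgp : Function.Periodic g (2 * π))
    {d : ℝ} (h : ∀ x, |f x - g x| ≤ d) (x : ℝ) :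
    |waveForce K a f x - waveForce K a g x| ≤ (4 * K + 1) * (16 * π ^ 2) * d := by
  have hu := abs_centeredPrimitive_sub_le (continuous_centeredPrimitive hf)
    (continuous_centeredPrimitive hg) (periodic_centeredPrimitive hf hfp)
    (periodic_centeredPrimitive hg hgp) (abs_centeredPrimitive_sub_le hf hg hfp hgp h)
  unfold waveForce
  set u := centeredPrimitive (centeredPrimitive f)
  set u' := centeredPrimitive (centeredPrimitive g)
  set e := 4 * π * (4 * π * d) with he
  have h1 := abs_le.1 (hu (x + a))
  have h2 := abs_le.1 (hu x)
  have h3 := abs_le.1 (hu (x - a))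
  have h4 : |sin (x + u x) - sin (x + u' x)| ≤ e := by
    refine (abs_sin_sub_sin_le _ _).trans ?_
    rw [add_sub_add_left_eq_sub]
    exact hu x
  have h4 := abs_le.1 h4
  have h5 : |(u (x + a) - 2 * u x + u (x - a)) - (u' (x + a) - 2 * u' x + u' (x - a))| ≤ 4 * e := by
    rw [abs_le]
    constructor <;> linarith
  have h6 := mul_le_mul_of_nonneg_left h5 hK
  rw [← abs_of_nonneg hK, ← abs_mul, abs_of_nonneg hK, abs_le] at h6
  have h7 : (4 * K + 1) * (16 * π ^ 2) * d = K * (4 * e) + e := by rw [he]; ring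
  rw [h7, abs_le]
  constructor <;> linarith

theorem waveForce_zero (K a : ℝ) : waveForce K a (fun _ => 0) = fun x => -sin x := by
  funext x
  simp [waveForce, centeredPrimitive_zero]

theorem periodMean_waveForce_zero (K a : ℝ) : periodMean (waveForce K a fun _ => 0) = 0 := by
  simp [waveForce_zero, periodMean]

theorem waveMap_zero (K a ε δ : ℝ) : waveMap K a ε δ (fun _ => 0) = fun x => -(ε * sin x) := by
  funext x
  unfold waveMap
  rw [periodMean_waveForce_zero]
  simp [centeredPrimitive_zero, waveForce_zero, periodMean_const]

theorem continuous_waveMap (K a ε δ : ℝ) {w : ℝ → ℝ} (hw : Continuous w) :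
    Continuous (waveMap K a ε δ w) := by
  have := continuous_centeredPrimitive hw
  have := continuous_waveForce K a hw
  unfold waveMap
  fun_prop

theorem periodic_waveMap (K a ε δ : ℝ) {w : ℝ → ℝ} (hw : Continuous w)
    (hp : Function.Periodic w (2 * π)) : Function.Periodic (waveMap K a ε δ w) (2 * π) := by
  intro x
  unfold waveMap
  rw [periodic_centeredPrimitive hw hp, periodic_waveForce K a hw hp]

theorem abs_waveMap_sub_le {K : ℝ} (hK : 0 ≤ K) (a : ℝ) {ε δ : ℝ} (hε : 0 ≤ ε) (hδ : 0 ≤ δ)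
    (hsmall : 2 * ((4 * K + 1) * (16 * π ^ 2)) * ε + 8 * π * δ ≤ 1 / 2)
    {f g : ℝ → ℝ} (hf : Continuous f)
    (hg : Continuous g) (hfp : Function.Periodic f (2 * π)) (hgp : Function.Periodic g (2 * π))
    {d : ℝ} (h : ∀ x, |f x - g x| ≤ d) (x : ℝ) :
    |waveMap K a ε δ f x - waveMap K a ε δ g x| ≤ d / 2 := by
  have hd : 0 ≤ d := (abs_nonneg _).trans (h 0)
  have hN := abs_waveForce_sub_le hK a hf hg hfp hgp h
  have hP := abs_centeredPrimitive_sub_le hf hg hfp hgp h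
  have hmN := abs_le.1 (abs_periodMean_sub_le (continuous_waveForce K a hf)
    (continuous_waveForce K a hg) hN)
  have hmP := abs_le.1 (abs_periodMean_sub_le (continuous_centeredPrimitive hf)
    (continuous_centeredPrimitive hg) hP)
  have hN := abs_le.1 (hN x)
  have hP := abs_le.1 (hP x)
  unfold waveMap
  set A := (4 * K + 1) * (16 * π ^ 2)
  rw [abs_le]
  constructor <;> nlinarith

/-- A bounded function whose bounds `d` improve to `d / 2 + c` is bounded by `2 * c`. -/
theorem abs_le_two_mul_of_improving_bound {g : ℝ → ℝ} {B c : ℝ} (hB : ∀ x, |g x| ≤ B)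
    (h : ∀ d, (∀ x, |g x| ≤ d) → ∀ x, |g x| ≤ d / 2 + c) (x : ℝ) : |g x| ≤ 2 * c := by
  have hbdd : BddAbove (Set.range fun x => |g x|) := ⟨B, by rintro _ ⟨y, rfl⟩; exact hB y⟩
  have h1 := h (⨆ y, |g y|) (le_ciSup hbdd)
  have h2 := ciSup_le h1
  linarith [le_ciSup hbdd x]

theorem exists_abs_le_of_periodic {w : ℝ → ℝ} (hw : Continuous w)
    (hp : Function.Periodic w (2 * π)) : ∃ B, ∀ x, |w x| ≤ B := by
  obtain ⟨B, hB⟩ := (hp.isBounded_of_continuous (by positivity) hw).exists_norm_le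
  exact ⟨B, fun x => hB _ ⟨x, rfl⟩⟩

open BoundedContinuousFunction in
theorem exists_fixedPoint_waveMap {K : ℝ} (hK : 0 ≤ K) (a : ℝ) {ε δ : ℝ} (hε : 0 ≤ ε)
    (hδ : 0 ≤ δ) (hsmall : 2 * ((4 * K + 1) * (16 * π ^ 2)) * ε + 8 * π * δ ≤ 1 / 2) :
    ∃ w : ℝ → ℝ, Continuous w ∧ Function.Periodic w (2 * π) ∧ waveMap K a ε δ w = w := by
  let s : Set (ℝ →ᵇ ℝ) := {w | Function.Periodic w (2 * π)}
  have hs : IsClosed s := by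
    have : s = ⋂ x : ℝ, {w : ℝ →ᵇ ℝ | w (x + 2 * π) = w x} := by
      ext w
      simp [s, Function.Periodic]
    rw [this]
    exact isClosed_iInter fun x => isClosed_eq
      (continuous_eval_const (x + 2 * π)) (continuous_eval_const x)
  have : CompleteSpace s := hs.completeSpace_coe
  have : Nonempty s := ⟨⟨0, fun x => by simp⟩⟩
  choose B hB using fun w : s => exists_abs_le_of_periodic
    (continuous_waveMap K a ε δ w.1.continuous) (periodic_waveMap K a ε δ w.1.continuous w.2)
  let G : s → s := fun w => ⟨BoundedContinuousFunction.ofNormedAddCommGroup (waveMap K a ε δ w.1)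
    (continuous_waveMap K a ε δ w.1.continuous) (B w) (hB w),
    periodic_waveMap K a ε δ w.1.continuous w.2⟩
  have hG : ContractingWith (1 / 2) G := by
    refine ⟨by norm_num, LipschitzWith.of_dist_le_mul fun f g => ?_⟩
    rw [Subtype.dist_eq, BoundedContinuousFunction.dist_le (by positivity)]
    intro x
    have h1 := abs_waveMap_sub_le hK a hε hδ hsmall f.1.continuous g.1.continuous f.2 g.2
      (d := dist f g) (fun y => BoundedContinuousFunction.dist_coe_le_dist (f := f.1) (g := g.1) y) x
    rw [Real.dist_eq]
    refine h1.trans (le_of_eq ?_)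
    push_cast
    ring
  have hfix := hG.fixedPoint_isFixedPt
  set w := hG.fixedPoint with hw
  refine ⟨w.1, w.1.continuous, w.2, ?_⟩
  funext x
  exact congrArg (fun z : s => z.1 x) hfix

theorem abs_fixedPoint_le {K : ℝ} (hK : 0 ≤ K) {a : ℝ} {ε δ : ℝ} (hε : 0 ≤ ε)
    (hδ : 0 ≤ δ) (hsmall : 2 * ((4 * K + 1) * (16 * π ^ 2)) * ε + 8 * π * δ ≤ 1 / 2)
    {w : ℝ → ℝ} (hw : Continuous w) (hp : Function.Periodic w (2 * π))
    (hfix : waveMap K a ε δ w = w) (x : ℝ) : |w x| ≤ 2 * ε := by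
  obtain ⟨B, hB⟩ := exists_abs_le_of_periodic hw hp
  refine abs_le_two_mul_of_improving_bound hB (fun d hd y => ?_) x
  have h1 := abs_le.1 (abs_waveMap_sub_le hK a hε hδ hsmall hw continuous_const hp (fun _ => rfl)
    (g := fun _ => 0) (by simpa using hd) y)
  rw [hfix, waveMap_zero] at h1
  have := neg_one_le_sin y
  have := sin_le_one y
  rw [abs_le]
  constructor <;> nlinarith

theorem abs_fixedPoint_sub_le {K : ℝ} (hK : 0 ≤ K) {a : ℝ} {ε δ ε' δ' : ℝ}
    (hε : 0 ≤ ε) (hδ : 0 ≤ δ) (hε' : 0 ≤ ε') (hδ' : 0 ≤ δ') (hε1' : ε' ≤ 1)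
    (hsmall : 2 * ((4 * K + 1) * (16 * π ^ 2)) * ε + 8 * π * δ ≤ 1 / 2)
    (hsmall' : 2 * ((4 * K + 1) * (16 * π ^ 2)) * ε' + 8 * π * δ' ≤ 1 / 2)
    {w w' : ℝ → ℝ} (hw : Continuous w) (hp : Function.Periodic w (2 * π))
    (hfix : waveMap K a ε δ w = w) (hw' : Continuous w') (hp' : Function.Periodic w' (2 * π))
    (hfix' : waveMap K a ε' δ' w' = w') (x : ℝ) :
    |w x - w' x| ≤ 2 * (|ε - ε'| * (4 * ((4 * K + 1) * (16 * π ^ 2)) + 2)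
      + |δ - δ'| * (16 * π)) := by
  obtain ⟨B, hB⟩ := exists_abs_le_of_periodic (hw.sub hw') (hp.sub hp')
  refine abs_le_two_mul_of_improving_bound (g := fun x => w x - w' x) hB (fun d hd y => ?_) x
  have h1 := abs_waveMap_sub_le hK a hε hδ hsmall hw hw' hp hp' hd y
  have hb : ∀ x, |w' x - 0| ≤ 2 := fun x => by
    rw [sub_zero]
    exact (abs_fixedPoint_le hK hε' hδ' hsmall' hw' hp' hfix' x).trans (by linarith)
  have hp0 : Function.Periodic (fun _ : ℝ => (0 : ℝ)) (2 * π) := fun _ => rfl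
  have hN := abs_waveForce_sub_le hK a hw' continuous_const hp' hp0 hb
  have hmN := abs_periodMean_sub_le (continuous_waveForce K a hw')
    (continuous_waveForce K a continuous_const) hN
  have hP := abs_centeredPrimitive_sub_le hw' continuous_const hp' hp0 hb
  have hmP := abs_periodMean_sub_le (continuous_centeredPrimitive hw')
    (continuous_centeredPrimitive continuous_const) hP
  rw [periodMean_waveForce_zero, sub_zero] at hmN
  rw [centeredPrimitive_zero, periodMean_const, sub_zero] at hmP
  have hN := hN y
  have hP := hP y
  rw [waveForce_zero] at hN
  rw [centeredPrimitive_zero, sub_zero] at hP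
  set A := (4 * K + 1) * (16 * π ^ 2)
  have h2 : |waveForce K a w' y - periodMean (waveForce K a w')| ≤ 4 * A + 2 := by
    have := neg_one_le_sin y
    have := sin_le_one y
    rw [abs_le] at *
    constructor <;> linarith
  have h3 : |centeredPrimitive w' y - periodMean (centeredPrimitive w')| ≤ 16 * π := by
    rw [abs_le] at *
    constructor <;> linarith
  have h4 : |waveMap K a ε δ w' y - waveMap K a ε' δ' w' y|
      ≤ |ε - ε'| * (4 * A + 2) + |δ - δ'| * (16 * π) := by
    have : waveMap K a ε δ w' y - waveMap K a ε' δ' w' y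
        = (ε - ε') * (waveForce K a w' y - periodMean (waveForce K a w'))
          - (δ - δ') * (centeredPrimitive w' y - periodMean (centeredPrimitive w')) := by
      unfold waveMap
      ring
    rw [this]
    refine (abs_sub _ _).trans ?_
    rw [abs_mul, abs_mul]
    gcongr
  rw [hfix] at h1
  rw [hfix'] at h4
  calc |w y - w' y| ≤ |w y - waveMap K a ε δ w' y| + |waveMap K a ε δ w' y - w' y| :=
        abs_sub_le _ _ _
    _ ≤ _ := add_le_add h1 h4

theorem periodMean_fixedPoint {K a ε δ : ℝ} {w : ℝ → ℝ} (hw : Continuous w)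
    (hfix : waveMap K a ε δ w = w) : periodMean w = 0 := by
  have hP := continuous_centeredPrimitive hw
  have hN := continuous_waveForce K a hw
  rw [← hfix]
  unfold waveMap
  rw [periodMean_sub (by fun_prop) (by fun_prop), periodMean_const_mul, periodMean_const_mul,
    periodMean_sub hN continuous_const, periodMean_sub hP continuous_const,
    periodMean_const, periodMean_const]
  ring

/-- A fixed point of `waveMap` yields a waveform when the velocity balances the mean force. -/
theorem isWaveform_of_fixedPoint {n m : ℕ} {Γ K F v : ℝ} (hv : 0 < v) {w : ℝ → ℝ}
    (hw : Continuous w) (hp : Function.Periodic w (2 * π))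
    (hfix : waveMap K ((m : ℝ) / n * (2 * π)) (v⁻¹ ^ 2) (Γ / v) w = w)
    (hF : Γ * v - periodMean (waveForce K ((m : ℝ) / n * (2 * π)) w) = F) :
    IsWaveform n m Γ K F v
      (fun t => v * t + centeredPrimitive (centeredPrimitive w) (v * t)) := by
  have hP := continuous_centeredPrimitive hw
  have hu := periodic_centeredPrimitive hP (periodic_centeredPrimitive hw hp)
  have hm := periodMean_fixedPoint hw hfix
  have hlin : ∀ t : ℝ, HasDerivAt (fun t => v * t) v t := fun t => by
    simpa using (hasDerivAt_id t).const_mul v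
  set f : ℝ → ℝ := fun t => v * t + centeredPrimitive (centeredPrimitive w) (v * t) with hf
  have hd1 : ∀ t, HasDerivAt f
      (v + (centeredPrimitive w (v * t) - periodMean (centeredPrimitive w)) * v) t := fun t =>
    (hlin t).add ((hasDerivAt_centeredPrimitive hP (v * t)).comp t (hlin t))
  have hderiv : deriv f =
      fun t => v + (centeredPrimitive w (v * t) - periodMean (centeredPrimitive w)) * v :=
    funext fun t => (hd1 t).deriv
  have hd2 : ∀ t, HasDerivAt (deriv f) (w (v * t) * v * v) t := fun t => by
    rw [hderiv]
    have h := (hasDerivAt_centeredPrimitive hw (v * t)).comp t (hlin t)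
    rw [hm, sub_zero] at h
    exact ((h.sub_const _).mul_const v).const_add v
  have hderiv2 : deriv (deriv f) = fun t => w (v * t) * v * v := funext fun t => (hd2 t).deriv
  refine ⟨?_, fun t => ?_, fun t => ?_⟩
  · rw [show (2 : WithTop ℕ∞) = 1 + 1 by norm_num, contDiff_succ_iff_deriv]
    refine ⟨fun t => (hd1 t).differentiableAt, by simp, ?_⟩
    rw [contDiff_one_iff_deriv]
    refine ⟨fun t => (hd2 t).differentiableAt, ?_⟩
    rw [hderiv2]
    fun_prop
  · have h : v * (t + 2 * π / v) = v * t + 2 * π := by field_simp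
    simp only [hf]
    rw [h, hu]
    ring
  · have h1 : v * (t + (m : ℝ) / n * (2 * π / v)) = v * t + (m : ℝ) / n * (2 * π) := by
      field_simp
    have h2 : v * (t - (m : ℝ) / n * (2 * π / v)) = v * t - (m : ℝ) / n * (2 * π) := by
      field_simp
    rw [hderiv2, hderiv]
    simp only [hf]
    rw [h1, h2]
    set a := (m : ℝ) / n * (2 * π)
    have key : w (v * t) * v * v = (waveForce K a w (v * t) - periodMean (waveForce K a w))
        - Γ * v * (centeredPrimitive w (v * t) - periodMean (centeredPrimitive w)) := by
      have h := congrFun hfix (v * t)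
      rw [← h]
      unfold waveMap
      field_simp
    have hW : waveForce K a w (v * t) = K * (centeredPrimitive (centeredPrimitive w) (v * t + a)
        - 2 * centeredPrimitive (centeredPrimitive w) (v * t)
        + centeredPrimitive (centeredPrimitive w) (v * t - a))
        - sin (v * t + centeredPrimitive (centeredPrimitive w) (v * t)) := rfl
    linear_combination key + hF + hW

/-- Fixing any `F̃ > 0` and `K̃ > 0`, there exists `Γ₀ > 0` such that for all
`0 < Γ ≤ Γ₀`, `F ≥ F̃` and `0 < K ≤ K̃` the discrete sine-Gordon ring admits a
travelling wave. -/
theorem exists_travellingWave_of_small_damping (n m : ℕ) (hn : 1 ≤ n) (hm : 1 ≤ m)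
    (Ftil Ktil : ℝ) (hFtil : 0 < Ftil) (hKtil : 0 < Ktil) :
    ∃ Γ₀ : ℝ, 0 < Γ₀ ∧ ∀ Γ F K : ℝ, 0 < Γ → Γ ≤ Γ₀ → Ftil ≤ F → 0 < K → K ≤ Ktil →
      ∃ v : ℝ, 0 < v ∧ ∃ f : ℝ → ℝ, IsWaveform n m Γ K F v f := by
  set A : ℝ := (4 * Ktil + 1) * (16 * π ^ 2) with hA
  have hA0 : 0 < A := by positivity
  set V : ℝ := 1 + 8 * A + 4 * A / Ftil + 32 * π with hV
  have hAF : 0 < 4 * A / Ftil := by positivity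
  have hpi := pi_pos
  have hV1 : 1 ≤ V := by linarith
  have hV0 : 0 < V := by linarith
  refine ⟨min 1 (Ftil / (2 * V)), by positivity, fun Γ F K hΓ hΓ₀ hF hK hKt => ?_⟩
  have hΓ1 : Γ ≤ 1 := hΓ₀.trans (min_le_left _ _)
  have hΓV : Γ * (2 * V) ≤ Ftil :=
    (le_div_iff₀ (by positivity)).1 (hΓ₀.trans (min_le_right _ _))
  set a : ℝ := (m : ℝ) / n * (2 * π) with ha
  have hKA : (4 * K + 1) * (16 * π ^ 2) ≤ A := by
    rw [hA]
    gcongr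
  have hKA0 : 0 < (4 * K + 1) * (16 * π ^ 2) := by positivity
  have hε : ∀ v, V ≤ v → v⁻¹ ^ 2 ≤ V⁻¹ ∧ v⁻¹ ^ 2 ≤ 1 := fun v hv => by
    have h1 : v⁻¹ ≤ V⁻¹ := inv_anti₀ hV0 hv
    have h2 : V⁻¹ ≤ 1 := inv_le_one_of_one_le₀ hV1
    have h3 : 0 ≤ v⁻¹ := inv_nonneg.2 (hV0.le.trans hv)
    constructor <;> nlinarith
  have hVinv : V⁻¹ * (8 * A + 32 * π) ≤ 1 := by
    rw [inv_mul_le_iff₀ hV0]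
    linarith
  have hVF : V⁻¹ * (4 * A) ≤ Ftil := by
    rw [inv_mul_le_iff₀ hV0]
    have : 4 * A / Ftil ≤ V := by linarith
    exact (div_le_iff₀ hFtil).1 this
  have hδ0 : ∀ v, V ≤ v → 0 ≤ Γ / v := fun v hv => div_nonneg hΓ.le (hV0.le.trans hv)
  have hsmall : ∀ v, V ≤ v →
      2 * ((4 * K + 1) * (16 * π ^ 2)) * v⁻¹ ^ 2 + 8 * π * (Γ / v) ≤ 1 / 2 := fun v hv => by
    have h1 : v⁻¹ ≤ V⁻¹ := inv_anti₀ hV0 hv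
    have h2 : Γ / v ≤ V⁻¹ := by
      rw [div_eq_mul_inv]
      have : 0 ≤ v⁻¹ := inv_nonneg.2 (hV0.le.trans hv)
      nlinarith
    have h3 : 2 * ((4 * K + 1) * (16 * π ^ 2)) * v⁻¹ ^ 2 ≤ 2 * A * V⁻¹ := by
      gcongr
      exact (hε v hv).1
    have h4 : 8 * π * (Γ / v) ≤ 8 * π * V⁻¹ := by gcongr
    nlinarith
  have hex : ∀ v, ∃ w : ℝ → ℝ, V ≤ v → Continuous w ∧ Function.Periodic w (2 * π) ∧
      waveMap K a (v⁻¹ ^ 2) (Γ / v) w = w := fun v => by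
    by_cases hv : V ≤ v
    · obtain ⟨w, hw⟩ :=
        exists_fixedPoint_waveMap hK.le a (sq_nonneg v⁻¹) (hδ0 v hv) (hsmall v hv)
      exact ⟨w, fun _ => hw⟩
    · exact ⟨0, fun h => absurd h hv⟩
  choose W hW using hex
  have hmean : ∀ v, V ≤ v → |periodMean (waveForce K a (W v))| ≤ Ftil / 2 := fun v hv => by
    obtain ⟨hc, hp, hfix⟩ := hW v hv
    have hb := abs_fixedPoint_le hK.le (sq_nonneg v⁻¹) (hδ0 v hv) (hsmall v hv) hc hp hfix
    have h1 := abs_periodMean_sub_le (continuous_waveForce K a hc)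
      (continuous_waveForce K a continuous_const)
      (abs_waveForce_sub_le hK.le a hc continuous_const hp (fun _ => rfl)
        (g := fun _ => 0) (by simpa only [sub_zero] using hb))
    rw [periodMean_waveForce_zero, sub_zero] at h1
    refine h1.trans ?_
    have : (4 * K + 1) * (16 * π ^ 2) * (2 * v⁻¹ ^ 2) ≤ A * (2 * V⁻¹) := by
      gcongr
      exact (hε v hv).1
    linarith
  set Φ : ℝ → ℝ := fun v => Γ * v - periodMean (waveForce K a (W v)) with hΦ
  have hcont : ContinuousOn Φ (Set.Ici V) := by
    refine (by fun_prop : Continuous fun v : ℝ => Γ * v).continuousOn.sub fun v₀ hv₀ => ?_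
    have hv₀' : v₀ ≠ 0 := (hV0.trans_le hv₀).ne'
    rw [ContinuousWithinAt, tendsto_iff_dist_tendsto_zero]
    refine squeeze_zero' (g := fun v => (4 * K + 1) * (16 * π ^ 2) *
      (2 * (|v⁻¹ ^ 2 - v₀⁻¹ ^ 2| * (4 * ((4 * K + 1) * (16 * π ^ 2)) + 2)
        + |Γ / v - Γ / v₀| * (16 * π)))) (Filter.Eventually.of_forall fun _ => dist_nonneg) ?_ ?_
    · filter_upwards [self_mem_nhdsWithin] with v hv
      obtain ⟨hc, hp, hfix⟩ := hW v hv
      obtain ⟨hc₀, hp₀, hfix₀⟩ := hW v₀ hv₀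
      exact abs_periodMean_sub_le (continuous_waveForce K a hc) (continuous_waveForce K a hc₀)
        (abs_waveForce_sub_le hK.le a hc hc₀ hp hp₀
          (abs_fixedPoint_sub_le hK.le (sq_nonneg _) (hδ0 v hv) (sq_nonneg _) (hδ0 v₀ hv₀)
            (hε v₀ hv₀).2 (hsmall v hv) (hsmall v₀ hv₀) hc hp hfix hc₀ hp₀ hfix₀))
    · have : ContinuousAt (fun v => (4 * K + 1) * (16 * π ^ 2) *
        (2 * (|v⁻¹ ^ 2 - v₀⁻¹ ^ 2| * (4 * ((4 * K + 1) * (16 * π ^ 2)) + 2)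
          + |Γ / v - Γ / v₀| * (16 * π)))) v₀ := by
        fun_prop (disch := assumption)
      have h := this.tendsto.mono_left (nhdsWithin_le_nhds (s := Set.Ici V))
      simpa using h
  set V' : ℝ := (F + Ftil / 2) / Γ with hV'
  have hVV' : V ≤ V' := by
    rw [hV', le_div_iff₀ hΓ]
    nlinarith
  have hlow : Φ V ≤ F := by
    have := abs_le.1 (hmean V le_rfl)
    simp only [hΦ]
    linarith
  have hhigh : F ≤ Φ V' := by
    have := abs_le.1 (hmean V' hVV')
    have h : Γ * V' = F + Ftil / 2 := by rw [hV']; field_simp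
    simp only [hΦ]
    linarith
  obtain ⟨v, hv, hvF⟩ := intermediate_value_Icc hVV'
    (hcont.mono Set.Icc_subset_Ici_self) ⟨hlow, hhigh⟩
  obtain ⟨hc, hp, hfix⟩ := hW v hv.1
  exact ⟨v, hV0.trans_le hv.1, _, isWaveform_of_fixedPoint (hV0.trans_le hv.1) hc hp hfix hvF⟩
end

section
/- The velocity v = 2π/T of any travelling wave of the discrete sine-Gordon ring satisfies the upper bound v < F/Γ; moreover, if F > 1, then it also satisfies the lower bound v > (F − 1)/Γ. -/
open Function intervalIntegral in
/-- The integral over a period of the derivative of a periodic function vanishes. -/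
lemma Function.Periodic.integral_deriv_eq_zero {g g' : ℝ → ℝ} {T : ℝ} (hg : Periodic g T)
    (hd : ∀ t, HasDerivAt g (g' t) t) (hc : Continuous g') : ∫ t in (0 : ℝ)..T, g' t = 0 := by
  rw [integral_eq_sub_of_hasDerivAt (fun t _ => hd t) (hc.intervalIntegrable _ _)]
  simpa [sub_eq_zero] using hg 0

/-- The integral of a periodic function over a period is invariant under translation. -/
lemma Function.Periodic.integral_comp_add_right {g : ℝ → ℝ} {T : ℝ} (hg : Function.Periodic g T)
    (s : ℝ) : ∫ t in (0 : ℝ)..T, g (t + s) = ∫ t in (0 : ℝ)..T, g t := by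
  rw [intervalIntegral.integral_comp_add_right g s]
  have h := hg.intervalIntegral_add_eq s 0
  simpa [add_comm] using h

section QuasiPeriodic

variable {f f' : ℝ → ℝ} {T c : ℝ}

lemma periodic_deriv_of_add_eq_add_const (hq : ∀ t, f (t + T) = f t + c)
    (hd : ∀ t, HasDerivAt f (f' t) t) : Function.Periodic f' T := fun t => by
  have h1 : HasDerivAt (fun x => f (x + T)) (f' (t + T)) t := (hd (t + T)).comp_add_const t T
  simp only [hq] at h1
  exact h1.unique ((hd t).add_const c)

lemma periodic_sub_shift_of_add_eq_add_const (hq : ∀ t, f (t + T) = f t + c) (s : ℝ) :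
    Function.Periodic (fun t => f t - f (t - s)) T := fun t => by
  have h := hq (t - s)
  rw [show t - s + T = t + T - s by ring] at h
  simp only [hq, h]
  ring

/-- The discrete Laplacian of a quasi-periodic function has zero mean. -/
lemma integral_discreteLaplacian_eq_zero (hq : ∀ t, f (t + T) = f t + c)
    (hf : Continuous f) (s : ℝ) :
    ∫ t in (0 : ℝ)..T, (f (t + s) - 2 * f t + f (t - s)) = 0 := by
  have h := (periodic_sub_shift_of_add_eq_add_const hq s).integral_comp_add_right s
  rw [← sub_eq_zero, ← intervalIntegral.integral_sub
    (Continuous.intervalIntegrable (by fun_prop) _ _)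
    (Continuous.intervalIntegrable (by fun_prop) _ _)] at h
  rw [← h]
  congr 1
  ext t
  rw [add_sub_cancel_right]
  ring

/-- The discrete Laplacian of a quasi-periodic function is orthogonal to its derivative. -/
lemma integral_discreteLaplacian_mul_deriv_eq_zero (hq : ∀ t, f (t + T) = f t + c)
    (hd : ∀ t, HasDerivAt f (f' t) t) (hc : Continuous f') (s : ℝ) :
    ∫ t in (0 : ℝ)..T, (f (t + s) - 2 * f t + f (t - s)) * f' t = 0 := by
  have hf : Continuous f := continuous_iff_continuousAt.2 fun t => (hd t).continuousAt
  have hp := periodic_sub_shift_of_add_eq_add_const hq s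
  have hp' := periodic_deriv_of_add_eq_add_const hq hd
  have hsq : ∫ t in (0 : ℝ)..T, 2 * (f t - f (t - s)) * (f' t - f' (t - s)) = 0 := by
    refine Function.Periodic.integral_deriv_eq_zero (g := fun t => (f t - f (t - s)) ^ 2)
      (fun t => congrArg (· ^ 2) (hp t)) (fun t => ?_) (by fun_prop)
    exact (((hd t).sub ((hd (t - s)).comp_sub_const t s)).pow 2).congr_deriv (by simp)
  have hshift : ∫ t in (0 : ℝ)..T, (f (t + s) - f t) * f' t
      = ∫ t in (0 : ℝ)..T, (f t - f (t - s)) * f' (t - s) := by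
    have hper : Function.Periodic (fun t => (f t - f (t - s)) * f' (t - s)) T :=
      hp.mul (hp'.sub_const s)
    simpa using hper.integral_comp_add_right s
  have hsplit : ∫ t in (0 : ℝ)..T, (f (t + s) - 2 * f t + f (t - s)) * f' t
      = (∫ t in (0 : ℝ)..T, (f (t + s) - f t) * f' t)
        - ∫ t in (0 : ℝ)..T, (f t - f (t - s)) * f' t := by
    rw [← intervalIntegral.integral_sub
      (Continuous.intervalIntegrable (by fun_prop) _ _)
      (Continuous.intervalIntegrable (by fun_prop) _ _)]
    congr 1
    ext t
    ring
  rw [hsplit, hshift, ← intervalIntegral.integral_sub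
    (Continuous.intervalIntegrable (by fun_prop) _ _)
    (Continuous.intervalIntegrable (by fun_prop) _ _)]
  have hneg : ∀ t, (f t - f (t - s)) * f' (t - s) - (f t - f (t - s)) * f' t
      = (-1 / 2) * (2 * (f t - f (t - s)) * (f' t - f' (t - s))) := fun t => by ring
  simp only [hneg, intervalIntegral.integral_const_mul, hsq, mul_zero]

end QuasiPeriodic

namespace IsWaveform

variable {n m : ℕ} {Γ K F v : ℝ} {f : ℝ → ℝ}

lemma hasDerivAt (hf : IsWaveform n m Γ K F v f) (t : ℝ) : HasDerivAt f (deriv f t) t :=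
  (hf.1.differentiable (by norm_num) t).hasDerivAt

lemma contDiff_deriv (hf : IsWaveform n m Γ K F v f) : ContDiff ℝ 1 (deriv f) :=
  (contDiff_succ_iff_deriv (n := 1).1 hf.1).2.2

lemma hasDerivAt_deriv (hf : IsWaveform n m Γ K F v f) (t : ℝ) :
    HasDerivAt (deriv f) (deriv (deriv f) t) t :=
  (hf.contDiff_deriv.differentiable (by norm_num) t).hasDerivAt

lemma continuous_deriv_deriv (hf : IsWaveform n m Γ K F v f) : Continuous (deriv (deriv f)) :=
  hf.contDiff_deriv.continuous_deriv le_rfl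

lemma periodic_deriv (hf : IsWaveform n m Γ K F v f) :
    Function.Periodic (deriv f) (2 * Real.pi / v) :=
  periodic_deriv_of_add_eq_add_const hf.2.1 hf.hasDerivAt

lemma integral_deriv (hf : IsWaveform n m Γ K F v f) :
    ∫ t in (0 : ℝ)..(2 * Real.pi / v), deriv f t = 2 * Real.pi := by
  rw [intervalIntegral.integral_eq_sub_of_hasDerivAt (fun t _ => hf.hasDerivAt t)
    (hf.contDiff_deriv.continuous.intervalIntegrable _ _)]
  have h := hf.2.1 0
  rw [zero_add] at h
  linarith

/-- Mean force balance over a period. -/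
lemma integral_sin (hf : IsWaveform n m Γ K F v f) :
    ∫ t in (0 : ℝ)..(2 * Real.pi / v), Real.sin (f t)
      = F * (2 * Real.pi / v) - Γ * (2 * Real.pi) := by
  have c0 := hf.1.continuous
  have c1 := hf.contDiff_deriv.continuous
  have c2 := hf.continuous_deriv_deriv
  set s := ((m : ℝ) / n) * (2 * Real.pi / v)
  have h2 := hf.periodic_deriv.integral_deriv_eq_zero hf.hasDerivAt_deriv c2
  have hL := integral_discreteLaplacian_eq_zero hf.2.1 c0 s
  have he : ∀ t, Real.sin (f t) = F + K * (f (t + s) - 2 * f t + f (t - s))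
      - deriv (deriv f) t - Γ * deriv f t := fun t => by linarith [hf.2.2 t]
  simp only [he]
  rw [intervalIntegral.integral_sub (Continuous.intervalIntegrable (by fun_prop) _ _)
      (Continuous.intervalIntegrable (by fun_prop) _ _),
    intervalIntegral.integral_sub (Continuous.intervalIntegrable (by fun_prop) _ _)
      (Continuous.intervalIntegrable (by fun_prop) _ _),
    intervalIntegral.integral_add (Continuous.intervalIntegrable (by fun_prop) _ _)
      (Continuous.intervalIntegrable (by fun_prop) _ _),
    intervalIntegral.integral_const_mul, intervalIntegral.integral_const_mul, hL, h2,
    hf.integral_deriv, intervalIntegral.integral_const]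
  simp only [smul_eq_mul]
  ring

/-- Energy balance over a period. -/
lemma integral_deriv_sq (hf : IsWaveform n m Γ K F v f) :
    Γ * ∫ t in (0 : ℝ)..(2 * Real.pi / v), deriv f t ^ 2 = F * (2 * Real.pi) := by
  have c0 := hf.1.continuous
  have c1 := hf.contDiff_deriv.continuous
  have c2 := hf.continuous_deriv_deriv
  set s := ((m : ℝ) / n) * (2 * Real.pi / v)
  have hE : ∫ t in (0 : ℝ)..(2 * Real.pi / v),
      (deriv f t * deriv (deriv f) t + Real.sin (f t) * deriv f t) = 0 := by
    refine Function.Periodic.integral_deriv_eq_zero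
      (g := fun t => deriv f t ^ 2 / 2 - Real.cos (f t)) (fun t => ?_) (fun t => ?_)
      (by fun_prop)
    · simp only [hf.periodic_deriv t, hf.2.1 t, Real.cos_add_two_pi]
    · have h := (((hf.hasDerivAt_deriv t).pow 2).div_const 2).sub (hf.hasDerivAt t).cos
      exact h.congr_deriv (by push_cast; ring)
  have hL := integral_discreteLaplacian_mul_deriv_eq_zero hf.2.1 hf.hasDerivAt c1 s
  have he : ∀ t, Γ * deriv f t ^ 2 = F * deriv f t
      + K * ((f (t + s) - 2 * f t + f (t - s)) * deriv f t)
      - (deriv f t * deriv (deriv f) t + Real.sin (f t) * deriv f t) := fun t => by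
    linear_combination deriv f t * hf.2.2 t
  rw [← intervalIntegral.integral_const_mul]
  simp only [he]
  rw [intervalIntegral.integral_sub (Continuous.intervalIntegrable (by fun_prop) _ _)
      (Continuous.intervalIntegrable (by fun_prop) _ _),
    intervalIntegral.integral_add (Continuous.intervalIntegrable (by fun_prop) _ _)
      (Continuous.intervalIntegrable (by fun_prop) _ _),
    intervalIntegral.integral_const_mul, intervalIntegral.integral_const_mul, hL, hE,
    hf.integral_deriv]
  ring

/-- A waveform does not move at constant speed. -/
lemma exists_deriv_ne (hf : IsWaveform n m Γ K F v f) (hv : 0 < v) :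
    ∃ t, deriv f t ≠ v := by
  by_contra! h
  have hconst : ∀ t, f t = f 0 + v * t := fun t => by
    have hd : ∀ x, HasDerivAt (fun y => f y - v * y) 0 x := fun x => by
      exact ((hf.hasDerivAt x).sub ((hasDerivAt_id x).const_mul v)).congr_deriv (by simp [h x])
    have := is_const_of_deriv_eq_zero (fun x => (hd x).differentiableAt) (fun x => (hd x).deriv) t 0
    simp only [mul_zero, sub_zero] at this
    linarith
  have hsin : ∀ x, Real.sin x = F - Γ * v := fun x => by
    have he := hf.2.2 ((x - f 0) / v)
    have hx : f ((x - f 0) / v) = x := by rw [hconst]; field_simp; ring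
    have h2 : deriv (deriv f) ((x - f 0) / v) = 0 := by
      rw [show deriv f = fun _ => v from funext h, deriv_const]
    rw [h2, h, hx, hconst (_ + _), hconst (_ - _)] at he
    have hy : v * ((x - f 0) / v) = x - f 0 := by field_simp
    linear_combination he + 2 * K * hy
  have h0 := hsin 0
  have h1 := hsin (Real.pi / 2)
  rw [Real.sin_zero] at h0
  rw [Real.sin_pi_div_two] at h1
  linarith

lemma exists_mem_Icc_sin_lt_one (hf : IsWaveform n m Γ K F v f) (hv : 0 < v) :
    ∃ t ∈ Set.Icc 0 (2 * Real.pi / v), Real.sin (f t) < 1 := by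
  have hT : 0 < 2 * Real.pi / v := by positivity
  rcases (Real.sin_le_one (f 0)).lt_or_eq with h | h
  · exact ⟨0, ⟨le_rfl, hT.le⟩, h⟩
  · have hq := hf.2.1 0
    rw [zero_add] at hq
    obtain ⟨t, ht, hft⟩ := intermediate_value_Icc hT.le hf.1.continuous.continuousOn
      (show f 0 + Real.pi ∈ Set.Icc (f 0) (f (2 * Real.pi / v)) by
        constructor <;> linarith [Real.pi_pos])
    refine ⟨t, ht, ?_⟩
    rw [hft, Real.sin_add_pi, h]
    norm_num

lemma velocity_lt (hf : IsWaveform n m Γ K F v f) (hΓ : 0 < Γ) (hv : 0 < v) :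
    v < F / Γ := by
  have hT : 0 < 2 * Real.pi / v := by positivity
  have c1 := hf.contDiff_deriv.continuous
  obtain ⟨a, ha⟩ := hf.exists_deriv_ne hv
  obtain ⟨b, hb, hab⟩ := hf.periodic_deriv.exists_mem_Ico₀ hT a
  have hpos : 0 < ∫ t in (0 : ℝ)..(2 * Real.pi / v), (deriv f t - v) ^ 2 := by
    refine intervalIntegral.integral_pos hT (by fun_prop) (fun t _ => sq_nonneg _)
      ⟨b, Set.Ico_subset_Icc_self hb, ?_⟩
    rw [← hab]
    exact sq_pos_of_ne_zero (sub_ne_zero.2 ha)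
  have hexp : ∫ t in (0 : ℝ)..(2 * Real.pi / v), (deriv f t - v) ^ 2
      = (∫ t in (0 : ℝ)..(2 * Real.pi / v), deriv f t ^ 2) - v * (2 * Real.pi) := by
    have he : ∀ t, (deriv f t - v) ^ 2 = deriv f t ^ 2 - 2 * v * deriv f t + v ^ 2 :=
      fun t => by ring
    simp only [he]
    rw [intervalIntegral.integral_add (Continuous.intervalIntegrable (by fun_prop) _ _)
        (Continuous.intervalIntegrable (by fun_prop) _ _),
      intervalIntegral.integral_sub (Continuous.intervalIntegrable (by fun_prop) _ _)
        (Continuous.intervalIntegrable (by fun_prop) _ _),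
      intervalIntegral.integral_const_mul, hf.integral_deriv, intervalIntegral.integral_const,
      smul_eq_mul]
    field_simp
    ring
  rw [hexp] at hpos
  have h := mul_pos hΓ hpos
  rw [mul_sub, hf.integral_deriv_sq] at h
  rw [lt_div_iff₀ hΓ]
  refine lt_of_mul_lt_mul_right (a := 2 * Real.pi) ?_ Real.two_pi_pos.le
  linarith

lemma lt_velocity (hf : IsWaveform n m Γ K F v f) (hΓ : 0 < Γ) (hv : 0 < v) :
    (F - 1) / Γ < v := by
  have hT : 0 < 2 * Real.pi / v := by positivity
  have c0 := hf.1.continuous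
  obtain ⟨t, ht, hlt⟩ := hf.exists_mem_Icc_sin_lt_one hv
  have hpos : 0 < ∫ t in (0 : ℝ)..(2 * Real.pi / v), (1 - Real.sin (f t)) :=
    intervalIntegral.integral_pos hT (by fun_prop)
      (fun t _ => sub_nonneg.2 (Real.sin_le_one _)) ⟨t, ht, sub_pos.2 hlt⟩
  rw [intervalIntegral.integral_sub (Continuous.intervalIntegrable (by fun_prop) _ _)
    (Continuous.intervalIntegrable (by fun_prop) _ _), hf.integral_sin,
    intervalIntegral.integral_const, smul_eq_mul] at hpos
  rw [div_lt_iff₀ hΓ]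
  refine lt_of_mul_lt_mul_right (a := 2 * Real.pi / v) ?_ hT.le
  have hvT : v * Γ * (2 * Real.pi / v) = Γ * (2 * Real.pi) := by field_simp
  linarith

end IsWaveform

/-- The velocity `v` of any travelling wave satisfies the upper bound `v < F/Γ`;
moreover, if `F > 1`, then it also satisfies the lower bound `v > (F − 1)/Γ`. -/
theorem velocity_bounds (n m : ℕ) (hn : 1 ≤ n) (hm : 1 ≤ m)
    (Γ K F v : ℝ) (hΓ : 0 < Γ) (hK : 0 < K) (hF : 0 < F) (hv : 0 < v)
    (f : ℝ → ℝ) (hf : IsWaveform n m Γ K F v f) :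
    v < F / Γ ∧ (1 < F → (F - 1) / Γ < v) := by
  exact ⟨hf.velocity_lt hΓ hv, fun _ => hf.lt_velocity hΓ hv⟩
end

section
/- For every value λ > 0 there exists a solution of equation (wff) with parameter λ, i.e., a twice continuously differentiable 2π-periodic function u : ℝ → ℝ with ∫₀^{2π} u(s) ds = 0 satisfying the equation (wff). -/
open Real in
/-- `u` is a solution of equation (wff) with parameter `λ = lam`: a `C²`,
`2π`-periodic function with zero mean on `[0, 2π]` satisfying
`u'' + λΓu' + λ²sin(z+u) = λ²·(1/2π)∫₀^{2π} sin(s+u(s)) ds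
 + λ²K[u(z+2πm/n) − 2u(z) + u(z−2πm/n)]`. -/
def WffSolution (n m : ℕ) (Γ K lam : ℝ) (u : ℝ → ℝ) : Prop :=
  ContDiff ℝ 2 u ∧
  (∀ z : ℝ, u (z + 2 * π) = u z) ∧
  (∫ s in (0:ℝ)..(2 * π), u s) = 0 ∧
  (∀ z : ℝ, deriv (deriv u) z + lam * Γ * deriv u z + lam ^ 2 * Real.sin (z + u z)
      = lam ^ 2 * (1 / (2 * π)) * (∫ s in (0:ℝ)..(2 * π), Real.sin (s + u s))
        + lam ^ 2 * K * (u (z + 2 * π * m / n) - 2 * u z + u (z - 2 * π * m / n)))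

open Set Metric MeasureTheory Polynomial
open scoped Real

theorem exists_polynomial_eval_eq_det_one_add_smul {E : Type*} [NormedAddCommGroup E]
    [NormedSpace ℝ E] [FiniteDimensional ℝ E] (A : E →L[ℝ] E) :
    ∃ p : ℝ[X], p.natDegree ≤ Module.finrank ℝ E ∧
      ∀ t : ℝ, p.eval t = (ContinuousLinearMap.id ℝ E + t • A).det := by
  classical
  let b := Module.finBasis ℝ E
  let M := LinearMap.toMatrix b b (A : E →ₗ[ℝ] E)
  refine ⟨((X : ℝ[X]) • M.map C + (1 : Matrix _ _ ℝ).map C).det, ?_, fun t ↦ ?_⟩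
  · simpa using Polynomial.natDegree_det_X_add_C_le M 1
  · rw [ContinuousLinearMap.det, ← LinearMap.det_toMatrix b, ← Polynomial.coe_evalRingHom,
      RingHom.map_det]
    congr 1
    ext i j
    have h1 : LinearMap.toMatrix b b ((ContinuousLinearMap.id ℝ E + t • A : E →L[ℝ] E) : E →ₗ[ℝ] E)
        = 1 + t • M := by
      rw [ContinuousLinearMap.toLinearMap_add, ContinuousLinearMap.toLinearMap_smul, map_add,
        map_smul, ContinuousLinearMap.coe_id, LinearMap.toMatrix_id]
    rw [h1]
    by_cases hij : i = j
    · subst hij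
      simp only [RingHom.mapMatrix_apply, Matrix.map_apply, Matrix.add_apply, Matrix.smul_apply,
        smul_eq_mul, Matrix.one_apply_eq]
      simp only [coe_evalRingHom, eval_add, eval_mul, eval_X, eval_C]
      ring
    · simp only [RingHom.mapMatrix_apply, Matrix.map_apply, Matrix.add_apply, Matrix.smul_apply,
        smul_eq_mul, Matrix.one_apply_ne hij]
      simp only [coe_evalRingHom, eval_add, eval_mul, eval_X, eval_C]
      ring

theorem exists_lipschitzWith_indicator_closedBall {E F : Type*} [NormedAddCommGroup E]
    [NormedSpace ℝ E] [FiniteDimensional ℝ E] [NormedAddCommGroup F] [NormedSpace ℝ F]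
    {h : E → F} (hh : ContDiff ℝ 1 h) {ρ : ℝ} (h0 : ∀ x, ‖x‖ = ρ → h x = 0) :
    ∃ C, LipschitzWith C ((closedBall (0 : E) ρ).indicator h) := by
  obtain ⟨C, hC⟩ := hh.contDiffOn.exists_lipschitzOnWith (by norm_num)
    (convex_closedBall (0 : E) ρ) (isCompact_closedBall _ _)
  have key : ∀ x y : E, ‖x‖ ≤ ρ → ρ < ‖y‖ → dist (h x) 0 ≤ C * dist x y := by
    intro x y hx hy
    have hc : ContinuousOn (fun t : ℝ ↦ ‖AffineMap.lineMap x y t‖) (Icc 0 1) := by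
      apply Continuous.continuousOn
      exact (AffineMap.lineMap_continuous (p := x) (q := y)).norm
    obtain ⟨t, ht, hz⟩ := intermediate_value_Icc zero_le_one hc
      (show ρ ∈ Icc _ _ by simpa using ⟨hx, hy.le⟩)
    have := hC.dist_le_mul x (by simpa using hx) (AffineMap.lineMap x y t)
      (by simpa using hz.le)
    rw [h0 _ hz] at this
    refine this.trans ?_
    gcongr
    rw [dist_left_lineMap, Real.norm_of_nonneg ht.1]
    exact mul_le_of_le_one_left dist_nonneg ht.2
  refine ⟨C, LipschitzWith.of_dist_le_mul fun x y ↦ ?_⟩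
  by_cases hx : ‖x‖ ≤ ρ <;> by_cases hy : ‖y‖ ≤ ρ
  · rw [indicator_of_mem (by simpa using hx), indicator_of_mem (by simpa using hy)]
    exact hC.dist_le_mul x (by simpa using hx) y (by simpa using hy)
  · rw [indicator_of_mem (by simpa using hx), indicator_of_notMem (by simpa using hy)]
    exact key x y hx (not_le.1 hy)
  · rw [indicator_of_notMem (by simpa using hx), indicator_of_mem (by simpa using hy), dist_comm,
      dist_comm x]
    exact key y x hy (not_le.1 hx)
  · rw [indicator_of_notMem (by simpa using hx), indicator_of_notMem (by simpa using hy), dist_self]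
    positivity


theorem bijective_id_add_of_lipschitzWith {E : Type*} [NormedAddCommGroup E]
    [NormedSpace ℝ E] [CompleteSpace E] {g : E → E} {c : NNReal} (hg : LipschitzWith c g)
    (hc : c < 1) : Function.Bijective fun x ↦ x + g x := by
  have h : ApproximatesLinearOn (fun x ↦ x + g x) ((ContinuousLinearEquiv.refl ℝ E : E ≃L[ℝ] E) :
      E →L[ℝ] E) univ c := by
    intro x _ y _
    simpa [add_sub_add_comm, add_sub_cancel_left] using hg.norm_sub_le x y
  refine (h.toHomeomorph _ ?_).bijective
  rcases subsingleton_or_nontrivial E with hE | hE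
  · exact .inl hE
  · refine .inr ?_
    have : ‖((ContinuousLinearEquiv.refl ℝ E).symm : E →L[ℝ] E)‖₊ = 1 := by
      ext; simp
    rwa [this, inv_one]

theorem exists_integral_det_one_add_smul_fderiv_eq {E : Type*} [NormedAddCommGroup E]
    [NormedSpace ℝ E] [FiniteDimensional ℝ E] [MeasurableSpace E] [BorelSpace E]
    (μ : Measure E) [μ.IsAddHaarMeasure]
    {h : E → E} (hh : ContDiff ℝ 1 h) {ρ : ℝ} (h0 : ∀ x, ‖x‖ = ρ → h x = 0) :
    ∃ δ : ℝ, 0 < δ ∧ ∀ t ∈ Ioo 0 δ,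
      ∫ x in ball (0 : E) ρ, (ContinuousLinearMap.id ℝ E + t • fderiv ℝ h x).det ∂μ =
        μ.real (ball (0 : E) ρ) := by
  obtain ⟨C, hC⟩ := exists_lipschitzWith_indicator_closedBall hh h0
  set g := (closedBall (0 : E) ρ).indicator h with hgdef
  have hgout : ∀ x, x ∉ ball (0 : E) ρ → g x = 0 := by
    intro x hx
    simp only [mem_ball_zero_iff, not_lt] at hx
    rcases hx.eq_or_lt with hx | hx
    · rw [hgdef, indicator_apply_eq_zero]
      exact fun _ ↦ h0 x hx.symm
    · exact indicator_of_notMem (by simpa using hx) _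
  have hgin : ∀ x ∈ ball (0 : E) ρ, g x = h x := fun x hx ↦
    indicator_of_mem (ball_subset_closedBall hx) _
  have hdet : ∀ᶠ A : E →L[ℝ] E in nhds 0, 0 < (ContinuousLinearMap.id ℝ E + A).det := by
    have hc : Continuous fun A : E →L[ℝ] E ↦ (ContinuousLinearMap.id ℝ E + A).det :=
      ContinuousLinearMap.continuous_det.comp (continuous_const.add continuous_id)
    refine hc.continuousAt.eventually (lt_mem_nhds ?_)
    simp [ContinuousLinearMap.det]
  obtain ⟨η, hη, hηdet⟩ := Metric.eventually_nhds_iff.1 hdet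
  refine ⟨min (1 / (C + 1)) (η / (C + 1)), by positivity, fun t ht ↦ ?_⟩
  obtain ⟨ht0, ht1⟩ := ht
  have hC0 : (0 : ℝ) ≤ C := C.2
  rw [lt_min_iff, lt_div_iff₀ (by positivity), lt_div_iff₀ (by positivity)] at ht1
  have htg : LipschitzWith (Real.toNNReal t * C) (fun x ↦ t • g x) := by
    refine LipschitzWith.of_dist_le_mul fun x y ↦ ?_
    rw [dist_smul₀, Real.norm_of_nonneg ht0.le, NNReal.coe_mul, Real.coe_toNNReal _ ht0.le,
      mul_assoc]
    exact mul_le_mul_of_nonneg_left (hC.dist_le_mul x y) ht0.le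
  have hbij := bijective_id_add_of_lipschitzWith htg (by
    rw [← NNReal.coe_lt_coe]; simp [ht0.le]; nlinarith)
  have himage : (fun x ↦ x + t • g x) '' ball (0 : E) ρ = ball (0 : E) ρ := by
    ext y
    constructor
    · rintro ⟨x, hx, rfl⟩
      by_contra hy
      have := hbij.1 (a₁ := x) (a₂ := x + t • g x) (by simp [hgout _ hy])
      exact hy (by simpa only [← this] using hx)
    · intro hy
      obtain ⟨x, hx⟩ := hbij.2 y
      refine ⟨x, ?_, hx⟩
      by_contra hx'
      simp only [hgout x hx', smul_zero, add_zero] at hx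
      exact hx' (hx ▸ hy)
  have hderiv : ∀ x ∈ ball (0 : E) ρ, HasFDerivAt (fun x ↦ x + t • g x)
      (ContinuousLinearMap.id ℝ E + t • fderiv ℝ h x) x := by
    intro x hx
    have h1 : HasFDerivAt (fun x ↦ x + t • h x)
        (ContinuousLinearMap.id ℝ E + t • fderiv ℝ h x) x :=
      (hasFDerivAt_id x).add (((hh.differentiable (by norm_num)) x).hasFDerivAt.const_smul t)
    refine h1.congr_of_eventuallyEq ?_
    filter_upwards [isOpen_ball.mem_nhds hx] with y hy
    rw [hgin y hy]
  have hpos : ∀ x ∈ ball (0 : E) ρ,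
      0 < (ContinuousLinearMap.id ℝ E + t • fderiv ℝ h x).det := by
    intro x hx
    apply hηdet
    have h1 : HasFDerivAt g (fderiv ℝ h x) x := by
      refine ((hh.differentiable (by norm_num)) x).hasFDerivAt.congr_of_eventuallyEq ?_
      filter_upwards [isOpen_ball.mem_nhds hx] with y hy using hgin y hy
    have h2 : ‖fderiv ℝ h x‖ ≤ C := h1.le_of_lipschitz hC
    rw [dist_zero_right, norm_smul, Real.norm_of_nonneg ht0.le]
    nlinarith
  have := lintegral_abs_det_fderiv_eq_addHaar_image μ measurableSet_ball
    (fun x hx ↦ (hderiv x hx).hasFDerivWithinAt) hbij.1.injOn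
  rw [himage] at this
  rw [Measure.real, ← this, integral_eq_lintegral_of_nonneg_ae]
  · congr 1
    refine setLIntegral_congr_fun measurableSet_ball fun x hx ↦ ?_
    simp only [abs_of_pos (hpos x hx)]
  · filter_upwards [ae_restrict_mem measurableSet_ball] with x hx using (hpos x hx).le
  · refine Continuous.aestronglyMeasurable ?_
    exact ContinuousLinearMap.continuous_det.comp
      (continuous_const.add ((hh.continuous_fderiv (by norm_num)).const_smul t))

theorem integral_det_one_add_fderiv_eq {E : Type*} [NormedAddCommGroup E]
    [NormedSpace ℝ E] [FiniteDimensional ℝ E] [MeasurableSpace E] [BorelSpace E]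
    (μ : Measure E) [μ.IsAddHaarMeasure]
    {h : E → E} (hh : ContDiff ℝ 1 h) {ρ : ℝ} (h0 : ∀ x, ‖x‖ = ρ → h x = 0) :
    ∫ x in ball (0 : E) ρ, (ContinuousLinearMap.id ℝ E + fderiv ℝ h x).det ∂μ =
        μ.real (ball (0 : E) ρ) := by
  classical
  obtain ⟨δ, hδ, hδh⟩ := exists_integral_det_one_add_smul_fderiv_eq μ hh h0
  obtain ⟨s, hs, hcard⟩ := (Ioo_infinite hδ).exists_subset_card_eq (Module.finrank ℝ E + 1)
  have hne : s.Nonempty := by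
    rw [← Finset.card_pos]; omega
  have hinj : InjOn (id : ℝ → ℝ) s := injOn_id _
  have hinterp (A : E →L[ℝ] E) : (ContinuousLinearMap.id ℝ E + A).det =
      ∑ t ∈ s, (ContinuousLinearMap.id ℝ E + t • A).det * (Lagrange.basis s id t).eval 1 := by
    obtain ⟨p, hp, hpe⟩ := exists_polynomial_eval_eq_det_one_add_smul A
    have h1 := Lagrange.eq_interpolate (f := p) hinj (by
      rw [hcard]
      exact (Polynomial.degree_le_natDegree).trans_lt (by exact_mod_cast Nat.lt_succ_of_le hp))
    have h2 := hpe 1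
    rw [one_smul] at h2
    rw [← h2, h1, Lagrange.interpolate_apply, Polynomial.eval_finsetSum]
    simp [hpe]
  have hint (t : ℝ) : IntegrableOn
      (fun x ↦ (ContinuousLinearMap.id ℝ E + t • fderiv ℝ h x).det) (ball (0 : E) ρ) μ := by
    refine IntegrableOn.mono_set ?_ ball_subset_closedBall
    refine ContinuousOn.integrableOn_compact (isCompact_closedBall _ _) (Continuous.continuousOn ?_)
    exact ContinuousLinearMap.continuous_det.comp
      (continuous_const.add ((hh.continuous_fderiv (by norm_num)).const_smul t))
  simp_rw [hinterp (fderiv ℝ h _)]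
  rw [integral_finsetSum _ fun t _ ↦ (hint t).mul_const _]
  simp_rw [integral_mul_const]
  rw [Finset.sum_congr rfl fun t ht ↦ by rw [hδh t (hs ht)], ← Finset.mul_sum,
    ← Polynomial.eval_finsetSum, Lagrange.sum_basis hinj hne]
  simp

theorem exists_eq_zero_of_contDiff_of_eq_id_on_sphere {E : Type*} [NormedAddCommGroup E]
    [InnerProductSpace ℝ E] [FiniteDimensional ℝ E] {F : E → E} (hF : ContDiff ℝ 1 F) {ρ : ℝ}
    (hρ : 0 < ρ) (hid : ∀ x, ‖x‖ = ρ → F x = x) : ∃ x, F x = 0 := by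
  by_contra! hne
  borelize E
  let r : E → E := fun x ↦ (ρ / ‖F x‖) • F x
  have hr : ContDiff ℝ 1 r := (contDiff_const.div (hF.norm ℝ hne) (by simpa using hne)).smul hF
  have hnorm (x : E) : ‖r x‖ = ρ := by
    have : ‖F x‖ ≠ 0 := by simpa using hne x
    simp only [r, norm_smul, norm_div, norm_norm, Real.norm_of_nonneg hρ.le]
    field_simp
  have key := integral_det_one_add_fderiv_eq (μ := (volume : Measure E)) (h := r - id)
    (hr.sub contDiff_id) (ρ := ρ) fun x hx ↦ by
      have : ρ ≠ 0 := hρ.ne'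
      simp [r, hid x hx, hx, this]
  have hdet (x : E) : (ContinuousLinearMap.id ℝ E + fderiv ℝ (r - id) x).det = 0 := by
    have hd : DifferentiableAt ℝ r x := hr.differentiable (by norm_num) x
    rw [fderiv_sub hd differentiableAt_id, fderiv_id, add_sub_cancel]
    by_contra hA
    have hsurj : Function.Surjective (fderiv ℝ r x) := by
      have : IsUnit (fderiv ℝ r x : E →ₗ[ℝ] E) := by
        rw [LinearMap.isUnit_iff_isUnit_det, isUnit_iff_ne_zero]; exact hA
      exact ((Module.End.isUnit_iff _).1 this).2
    obtain ⟨v, hv⟩ := hsurj (r x)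
    have h1 : HasFDerivAt (fun y ↦ ‖r y‖ ^ 2) _ x := hd.hasFDerivAt.norm_sq
    simp_rw [hnorm] at h1
    have h2 := congrArg (fun L ↦ L v) (h1.unique (hasFDerivAt_const (ρ ^ 2) x))
    simp [hv, hnorm, hρ.ne'] at h2
  simp only [hdet, integral_zero] at key
  have : 0 < (volume : Measure E).real (ball (0 : E) ρ) :=
    ENNReal.toReal_pos (measure_ball_pos _ _ hρ).ne' measure_ball_lt_top.ne
  exact this.ne key

theorem exists_eq_zero_of_continuous_of_eq_id {E : Type*} [NormedAddCommGroup E]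
    [InnerProductSpace ℝ E] [FiniteDimensional ℝ E] {F : E → E} (hF : Continuous F) {ρ : ℝ}
    (hρ : 0 < ρ) (hid : ∀ x, ρ ≤ ‖x‖ → F x = x) : ∃ x, F x = 0 := by
  by_contra! hne
  obtain ⟨G, hG, hGF, hGS, -⟩ := hF.exists_contDiff_approx_and_eqOn (n := 1) hF.norm
    (fun x ↦ norm_pos_iff.2 (hne x)) (S := {x | ρ + 1 ≤ ‖x‖}) (U := {x | ρ < ‖x‖})
    (isClosed_le continuous_const continuous_norm)
    ((isOpen_lt continuous_const continuous_norm).mem_nhdsSet.2 fun x hx ↦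
      (lt_add_one ρ).trans_le hx)
    (contDiff_id.contDiffOn.congr fun x hx ↦ hid x (le_of_lt hx))
  obtain ⟨x, hx⟩ := exists_eq_zero_of_contDiff_of_eq_id_on_sphere hG (ρ := ρ + 1) (by positivity)
    fun x hx ↦ by rw [hGS hx.ge, hid x (by linarith)]
  simpa [hx] using hGF x

/-- **Brouwer fixed point theorem** for bounded continuous maps of a Euclidean space. -/
theorem exists_isFixedPt_of_continuous_of_bounded {E : Type*} [NormedAddCommGroup E]
    [InnerProductSpace ℝ E] [FiniteDimensional ℝ E] {f : E → E} (hf : Continuous f) {R : ℝ}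
    (hR : ∀ x, ‖f x‖ ≤ R) : ∃ x, f x = x := by
  let χ : E → ℝ := fun x ↦ max 0 (min 1 (R + 1 - ‖x‖))
  have hχ : Continuous χ := by fun_prop
  have hR0 : 0 ≤ R := (norm_nonneg _).trans (hR 0)
  obtain ⟨x, hx⟩ := exists_eq_zero_of_continuous_of_eq_id (F := fun x ↦ x - χ x • f x)
    (by fun_prop) (ρ := R + 1) (by positivity) fun x hx ↦ by
      have : χ x = 0 := max_eq_left ((min_le_right _ _).trans (by linarith))
      simp [this]
  rw [sub_eq_zero] at hx
  have hχ0 : 0 ≤ χ x := le_max_left _ _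
  have hχ1 : χ x ≤ 1 := max_le zero_le_one (min_le_left _ _)
  have hxR : ‖x‖ ≤ R := by
    rw [hx, norm_smul, Real.norm_of_nonneg hχ0]
    nlinarith [hR x, norm_nonneg (f x)]
  have : χ x = 1 := by
    simp only [χ]
    rw [min_eq_left (by linarith), max_eq_right zero_le_one]
  exact ⟨x, by simpa [this] using hx.symm⟩

theorem exists_dist_le_of_continuous_of_forall_mem_isCompact {X : Type*} [NormedAddCommGroup X]
    [NormedSpace ℝ X] {f : X → X} (hf : Continuous f) {K : Set X} (hK : IsCompact K)
    (hfK : ∀ x, f x ∈ K) {ε : ℝ} (hε : 0 < ε) : ∃ x, dist (f x) x ≤ ε := by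
  obtain ⟨t, -, htfin, htK⟩ := hK.finite_cover_balls hε
  have := htfin.fintype
  let w : t → X → ℝ := fun i y ↦ max 0 (ε - dist y i)
  have hw0 (i : t) (y : X) : 0 ≤ w i y := le_max_left _ _
  have hwc (i : t) : Continuous (w i) := by fun_prop
  have hW (y : X) (hy : y ∈ K) : 0 < ∑ i, w i y := by
    obtain ⟨i, hi, hyi⟩ := mem_iUnion₂.1 (htK hy)
    refine Finset.sum_pos' (fun i _ ↦ hw0 i y) ⟨⟨i, hi⟩, Finset.mem_univ _, ?_⟩
    exact lt_max_of_lt_right (sub_pos.2 hyi)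
  let S : EuclideanSpace ℝ t → X := fun c ↦ ∑ i, c i • (i : X)
  have hS : Continuous S := by fun_prop
  let G : EuclideanSpace ℝ t → EuclideanSpace ℝ t := fun c ↦
    WithLp.toLp 2 fun i ↦ w i (f (S c)) / ∑ j, w j (f (S c))
  have hG : Continuous G := by
    refine (PiLp.continuous_toLp 2 _).comp (continuous_pi fun i ↦ ?_)
    exact ((hwc i).comp (hf.comp hS)).div
      (continuous_finsetSum _ fun j _ ↦ (hwc j).comp (hf.comp hS))
      fun c ↦ (hW _ (hfK _)).ne'
  obtain ⟨c, hc⟩ := exists_isFixedPt_of_continuous_of_bounded hG (R := √(∑ _i : t, 1)) fun c ↦ by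
    rw [EuclideanSpace.norm_eq]
    refine Real.sqrt_le_sqrt (Finset.sum_le_sum fun i _ ↦ ?_)
    have h1 : w i (f (S c)) / ∑ j, w j (f (S c)) ≤ 1 :=
      div_le_one_of_le₀ (Finset.single_le_sum (f := fun j ↦ w j (f (S c)))
        (fun j _ ↦ hw0 j _) (Finset.mem_univ i)) (hW _ (hfK _)).le
    have h0 : 0 ≤ w i (f (S c)) / ∑ j, w j (f (S c)) := div_nonneg (hw0 _ _) (hW _ (hfK _)).le
    simp only [G, Real.norm_of_nonneg h0]
    exact pow_le_one₀ h0 h1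
  have hci (i : t) : c i = w i (f (S c)) / ∑ j, w j (f (S c)) := by
    conv_lhs => rw [← hc]
  have hsum : ∑ i, c i = 1 := by
    simp_rw [hci, ← Finset.sum_div]
    exact div_self (hW _ (hfK _)).ne'
  have hc0 (i : t) : 0 ≤ c i := hci i ▸ div_nonneg (hw0 _ _) (hW _ (hfK _)).le
  refine ⟨S c, ?_⟩
  calc dist (f (S c)) (S c) = ‖∑ i, c i • (f (S c) - i)‖ := by
        simp_rw [smul_sub, Finset.sum_sub_distrib, ← Finset.sum_smul, hsum, one_smul, dist_eq_norm]
        rfl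
    _ ≤ ∑ i, c i * ε := by
        refine norm_sum_le_of_le _ fun i _ ↦ ?_
        rw [norm_smul, Real.norm_of_nonneg (hc0 i), ← dist_eq_norm]
        by_cases hd : dist (f (S c)) i ≤ ε
        · exact mul_le_mul_of_nonneg_left hd (hc0 i)
        · have : c i = 0 := by
            rw [hci, div_eq_zero_iff]
            exact .inl (max_eq_left (by linarith))
          simp [this]
    _ = ε := by rw [← Finset.sum_mul, hsum, one_mul]

/-- **Schauder fixed point theorem** for continuous maps of a normed space into a compact set. -/
theorem exists_isFixedPt_of_continuous_of_forall_mem_isCompact {X : Type*} [NormedAddCommGroup X]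
    [NormedSpace ℝ X] {f : X → X} (hf : Continuous f) {K : Set X} (hK : IsCompact K)
    (hfK : ∀ x, f x ∈ K) : ∃ x, f x = x := by
  choose x hx using fun n : ℕ ↦ exists_dist_le_of_continuous_of_forall_mem_isCompact hf hK hfK
    (Nat.one_div_pos_of_nat (α := ℝ) (n := n))
  obtain ⟨y, -, φ, hφ, hy⟩ := hK.tendsto_subseq fun n ↦ hfK (x n)
  have hdist : Filter.Tendsto (fun n ↦ dist (f (x (φ n))) (x (φ n))) Filter.atTop (nhds 0) :=
    (squeeze_zero (fun _ ↦ dist_nonneg) hx tendsto_one_div_add_atTop_nhds_zero_nat).comp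
      hφ.tendsto_atTop
  have hxy : Filter.Tendsto (fun n ↦ x (φ n)) Filter.atTop (nhds y) :=
    (tendsto_iff_of_dist hdist).1 hy
  exact ⟨y, tendsto_nhds_unique ((hf.tendsto y).comp hxy) hy⟩

/-- **Schaefer fixed point theorem**. -/
theorem exists_isFixedPt_of_forall_eq_smul_norm_lt {X : Type*} [NormedAddCommGroup X]
    [NormedSpace ℝ X] {T : X → X} (hT : Continuous T) {R : ℝ} (hR : 0 < R) {K : Set X}
    (hK : IsCompact K) (hTK : ∀ x, ‖x‖ ≤ R → T x ∈ K)
    (hpriori : ∀ s ∈ Icc (0 : ℝ) 1, ∀ x, x = s • T x → ‖x‖ < R) : ∃ x, T x = x := by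
  let ρ : X → X := fun x ↦ (R / max R ‖x‖) • x
  have hmax (x : X) : 0 < max R ‖x‖ := lt_max_of_lt_left hR
  have hρ : Continuous ρ :=
    (continuous_const.div (continuous_const.max continuous_norm) fun x ↦ (hmax x).ne').smul
      continuous_id
  have hρn (x : X) : ‖ρ x‖ = R / max R ‖x‖ * ‖x‖ := by
    rw [norm_smul, Real.norm_of_nonneg (div_nonneg hR.le (hmax x).le)]
  have hρR (x : X) : ‖ρ x‖ ≤ R := by
    rw [hρn, div_mul_eq_mul_div, div_le_iff₀ (hmax x)]
    exact mul_le_mul_of_nonneg_left (le_max_right _ _) hR.le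
  have hρid (x : X) (hx : ‖x‖ ≤ R) : ρ x = x := by
    simp only [ρ, max_eq_left hx, div_self hR.ne', one_smul]
  obtain ⟨x, hx⟩ := exists_isFixedPt_of_continuous_of_forall_mem_isCompact
    (hρ.comp (hT.comp hρ)) (hK.image hρ) fun x ↦ mem_image_of_mem ρ (hTK _ (hρR x))
  have hxR : ‖x‖ ≤ R := by rw [← hx]; exact hρR _
  simp only [Function.comp_apply, hρid x hxR] at hx
  refine ⟨x, ?_⟩
  rcases le_or_gt ‖T x‖ R with h | h
  · rwa [hρid _ h] at hx
  · have h1 : ‖x‖ < R := hpriori (R / max R ‖T x‖)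
      ⟨div_nonneg hR.le (hmax _).le, div_le_one_of_le₀ (le_max_left _ _) (hmax _).le⟩ x hx.symm
    have h2 := hρn (T x)
    rw [hx, max_eq_right h.le, div_mul_cancel₀ _ (hR.trans h).ne'] at h2
    exact absurd h2 h1.ne

theorem isCompact_closure_setOf_lipschitz_addCircle {τ : ℝ} [Fact (0 < τ)] (M L : ℝ) :
    IsCompact (closure {v : BoundedContinuousFunction (AddCircle τ) ℝ |
      (∀ x, |v x| ≤ M) ∧ ∀ x y : ℝ, |v x - v y| ≤ L * |x - y|}) := by
  refine BoundedContinuousFunction.arzela_ascoli (Icc (-M) M) isCompact_Icc _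
    (fun v x hv ↦ abs_le.1 (hv.1 x)) (UniformEquicontinuous.equicontinuous ?_)
  refine Metric.uniformEquicontinuous_of_continuity_modulus (fun d ↦ L * d)
    (Continuous.tendsto' (by fun_prop) _ _ (by simp)) _ fun x y v ↦ ?_
  induction x using QuotientAddGroup.induction_on with | H x =>
  induction y using QuotientAddGroup.induction_on with | H y =>
  have h1 := v.2.2 x (y + round (τ⁻¹ * (x - y)) * τ)
  have h2 : ((y + round (τ⁻¹ * (x - y)) * τ : ℝ) : AddCircle τ) = y := by
    rw [← zsmul_eq_mul, AddCircle.coe_add, AddCircle.coe_zsmul, AddCircle.coe_period, smul_zero,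
      add_zero]
  rw [h2, ← sub_sub] at h1
  rw [Real.dist_eq, dist_eq_norm (x : AddCircle τ), ← AddCircle.coe_sub, AddCircle.norm_eq]
  exact h1

theorem exists_boundedContinuousFunction_addCircle {τ : ℝ} [Fact (0 < τ)] {f : ℝ → ℝ}
    (hf : Continuous f) (hper : Function.Periodic f τ) :
    ∃ u : BoundedContinuousFunction (AddCircle τ) ℝ, ∀ z : ℝ, u z = f z :=
  ⟨BoundedContinuousFunction.mkOfCompact ⟨hper.lift, continuous_coinduced_dom.2 hf⟩,
    fun _ ↦ rfl⟩

/-- The primitive of `g` with zero mean over `[0, τ]`. -/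
noncomputable def zeroMeanPrimitive (τ : ℝ) (g : ℝ → ℝ) (z : ℝ) : ℝ :=
  (∫ s in (0 : ℝ)..z, g s) - τ⁻¹ * ∫ x in (0 : ℝ)..τ, ∫ s in (0 : ℝ)..x, g s

/-- The `τ`-periodic solution `v` of `v' + a v = g`. -/
noncomputable def periodicResolvent (τ a : ℝ) (g : ℝ → ℝ) (z : ℝ) : ℝ :=
  (1 - Real.exp (-(a * τ)))⁻¹ * (Real.exp (-(a * z)) * ∫ s in (z - τ)..z, Real.exp (a * s) * g s)

section

variable {τ a M : ℝ} {g g₁ g₂ : ℝ → ℝ}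

theorem hasDerivAt_zeroMeanPrimitive (hg : Continuous g) (z : ℝ) :
    HasDerivAt (zeroMeanPrimitive τ g) (g z) z :=
  (intervalIntegral.integral_hasDerivAt_right (hg.intervalIntegrable _ _)
    (hg.stronglyMeasurableAtFilter _ _) hg.continuousAt).sub_const _

theorem continuous_zeroMeanPrimitive (hg : Continuous g) : Continuous (zeroMeanPrimitive τ g) :=
  continuous_iff_continuousAt.2 fun z ↦ (hasDerivAt_zeroMeanPrimitive hg z).continuousAt

theorem periodic_zeroMeanPrimitive (hg : Continuous g) (hper : Function.Periodic g τ)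
    (hmean : ∫ s in (0 : ℝ)..τ, g s = 0) : Function.Periodic (zeroMeanPrimitive τ g) τ := by
  intro z
  simp only [zeroMeanPrimitive]
  rw [← intervalIntegral.integral_add_adjacent_intervals (hg.intervalIntegrable 0 z)
    (hg.intervalIntegrable z (z + τ)), hper.intervalIntegral_add_eq z 0, zero_add, hmean, add_zero]

theorem integral_zeroMeanPrimitive (hτ : 0 < τ) (hg : Continuous g) :
    ∫ z in (0 : ℝ)..τ, zeroMeanPrimitive τ g z = 0 := by
  simp only [zeroMeanPrimitive]
  rw [intervalIntegral.integral_sub]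
  · simp [hτ.ne']
  · exact (intervalIntegral.continuous_primitive
      (fun a b ↦ hg.intervalIntegrable a b) 0).intervalIntegrable _ _
  · exact intervalIntegrable_const

theorem zeroMeanPrimitive_sub (hg₁ : Continuous g₁) (hg₂ : Continuous g₂) (z : ℝ) :
    zeroMeanPrimitive τ (g₁ - g₂) z = zeroMeanPrimitive τ g₁ z - zeroMeanPrimitive τ g₂ z := by
  have h (z : ℝ) : ∫ s in (0 : ℝ)..z, (g₁ - g₂) s =
      (∫ s in (0 : ℝ)..z, g₁ s) - ∫ s in (0 : ℝ)..z, g₂ s :=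
    intervalIntegral.integral_sub (hg₁.intervalIntegrable _ _) (hg₂.intervalIntegrable _ _)
  have hc {g : ℝ → ℝ} (hg : Continuous g) :
      IntervalIntegrable (fun x ↦ ∫ s in (0 : ℝ)..x, g s) volume 0 τ :=
    (intervalIntegral.continuous_primitive
      (fun a b ↦ hg.intervalIntegrable a b) 0).intervalIntegrable _ _
  simp only [zeroMeanPrimitive, h]
  rw [intervalIntegral.integral_sub (hc hg₁) (hc hg₂)]
  ring

theorem abs_zeroMeanPrimitive_le (hτ : 0 < τ) (hg : Continuous g) (hper : Function.Periodic g τ)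
    (hmean : ∫ s in (0 : ℝ)..τ, g s = 0) (hM : ∀ z, |g z| ≤ M) (z : ℝ) :
    |zeroMeanPrimitive τ g z| ≤ 2 * τ * M := by
  have hM0 : 0 ≤ M := (abs_nonneg _).trans (hM 0)
  obtain ⟨y, hy, hzy⟩ := (periodic_zeroMeanPrimitive hg hper hmean).exists_mem_Ico₀ hτ z
  have h1 : ∀ x ∈ Icc 0 τ, |∫ s in (0 : ℝ)..x, g s| ≤ M * τ := by
    intro x hx
    rw [← Real.norm_eq_abs]
    refine (intervalIntegral.norm_integral_le_of_norm_le_const fun s _ ↦ hM s).trans ?_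
    rw [sub_zero, abs_of_nonneg hx.1]
    exact mul_le_mul_of_nonneg_left hx.2 hM0
  have h2 : |∫ x in (0 : ℝ)..τ, ∫ s in (0 : ℝ)..x, g s| ≤ M * τ * τ := by
    rw [← Real.norm_eq_abs]
    refine (intervalIntegral.norm_integral_le_of_norm_le_const (C := M * τ) fun s hs ↦ ?_).trans ?_
    · rw [uIoc_of_le hτ.le] at hs
      exact h1 s (Ioc_subset_Icc_self hs)
    · rw [sub_zero, abs_of_pos hτ]
  rw [hzy, zeroMeanPrimitive]
  refine (abs_sub _ _).trans ?_
  rw [abs_mul, abs_inv, abs_of_pos hτ]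
  have h3 : τ⁻¹ * |∫ x in (0 : ℝ)..τ, ∫ s in (0 : ℝ)..x, g s| ≤ M * τ := by
    rw [inv_mul_le_iff₀ hτ]; linarith
  linarith [h1 y (Ico_subset_Icc_self hy)]

theorem hasDerivAt_periodicResolvent (ha : 0 < a) (hτ : 0 < τ) (hg : Continuous g)
    (hper : Function.Periodic g τ) (z : ℝ) :
    HasDerivAt (periodicResolvent τ a g) (g z - a * periodicResolvent τ a g z) z := by
  have hF : Continuous fun s ↦ Real.exp (a * s) * g s := by fun_prop
  have hI (z : ℝ) : HasDerivAt (fun z ↦ ∫ s in (0 : ℝ)..z, Real.exp (a * s) * g s)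
      (Real.exp (a * z) * g z) z :=
    intervalIntegral.integral_hasDerivAt_right (hF.intervalIntegrable _ _)
      (hF.stronglyMeasurableAtFilter _ _) hF.continuousAt
  have hJ : HasDerivAt (fun z ↦ ∫ s in (z - τ)..z, Real.exp (a * s) * g s)
      (Real.exp (a * z) * g z - Real.exp (a * (z - τ)) * g (z - τ)) z := by
    refine ((hI z).sub ((hI (z - τ)).comp_sub_const z τ)).congr_of_eventuallyEq ?_
    refine Filter.Eventually.of_forall fun x ↦ ?_
    exact (intervalIntegral.integral_interval_sub_left (hF.intervalIntegrable _ _)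
      (hF.intervalIntegrable _ _)).symm
  have hE : HasDerivAt (fun z ↦ Real.exp (-(a * z))) (Real.exp (-(a * z)) * (-(a * 1))) z :=
    ((hasDerivAt_id z).const_mul a).neg.exp
  refine ((hE.mul hJ).const_mul (1 - Real.exp (-(a * τ)))⁻¹).congr_deriv ?_
  have h1 : 1 - Real.exp (-(a * τ)) ≠ 0 := by
    have : Real.exp (-(a * τ)) < 1 := Real.exp_lt_one_iff.2 (by nlinarith)
    linarith
  have h2 : Real.exp (-(a * z)) * Real.exp (a * z) = 1 := by rw [← Real.exp_add]; simp
  have h3 : Real.exp (-(a * z)) * Real.exp (a * (z - τ)) = Real.exp (-(a * τ)) := by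
    rw [← Real.exp_add]; ring_nf
  rw [hper.sub_eq, periodicResolvent]
  have h4 : Real.exp (-(a * z)) * (Real.exp (a * z) * g z - Real.exp (a * (z - τ)) * g z) =
      (1 - Real.exp (-(a * τ))) * g z := by
    rw [← h3]; linear_combination g z * h2
  rw [mul_add, h4, inv_mul_cancel_left₀ h1]
  ring

theorem continuous_periodicResolvent (ha : 0 < a) (hτ : 0 < τ) (hg : Continuous g)
    (hper : Function.Periodic g τ) : Continuous (periodicResolvent τ a g) :=
  continuous_iff_continuousAt.2 fun z ↦ (hasDerivAt_periodicResolvent ha hτ hg hper z).continuousAt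

theorem periodic_periodicResolvent (hper : Function.Periodic g τ) :
    Function.Periodic (periodicResolvent τ a g) τ := by
  intro z
  have h : ∫ s in (z + τ - τ)..(z + τ), Real.exp (a * s) * g s =
      Real.exp (a * τ) * ∫ s in (z - τ)..z, Real.exp (a * s) * g s := by
    rw [← intervalIntegral.integral_const_mul]
    have := intervalIntegral.integral_comp_add_right (a := z - τ) (b := z)
      (fun s ↦ Real.exp (a * s) * g s) τ
    rw [sub_add_cancel] at this
    rw [add_sub_cancel_right, ← this]
    refine intervalIntegral.integral_congr fun s _ ↦ ?_
    simp only [hper s, mul_add, Real.exp_add]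
    ring
  have h2 : Real.exp (-(a * (z + τ))) * Real.exp (a * τ) = Real.exp (-(a * z)) := by
    rw [← Real.exp_add]; ring_nf
  simp only [periodicResolvent]
  rw [h, ← h2]
  ring

theorem integral_periodicResolvent (ha : 0 < a) (hτ : 0 < τ) (hg : Continuous g)
    (hper : Function.Periodic g τ) (hmean : ∫ s in (0 : ℝ)..τ, g s = 0) :
    ∫ z in (0 : ℝ)..τ, periodicResolvent τ a g z = 0 := by
  have hc := continuous_periodicResolvent ha hτ hg hper
  have h := intervalIntegral.integral_eq_sub_of_hasDerivAt (a := 0) (b := τ)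
    (fun z _ ↦ hasDerivAt_periodicResolvent ha hτ hg hper z)
    (Continuous.intervalIntegrable (by fun_prop) _ _)
  rw [intervalIntegral.integral_sub (hg.intervalIntegrable _ _)
    (Continuous.intervalIntegrable (by fun_prop) _ _), hmean,
    intervalIntegral.integral_const_mul, (periodic_periodicResolvent hper).eq, sub_self] at h
  have : a ≠ 0 := ha.ne'
  simpa [this] using h

theorem periodicResolvent_sub (hg₁ : Continuous g₁) (hg₂ : Continuous g₂) (z : ℝ) :
    periodicResolvent τ a (g₁ - g₂) z = periodicResolvent τ a g₁ z - periodicResolvent τ a g₂ z := by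
  have hc {g : ℝ → ℝ} (hg : Continuous g) :
      IntervalIntegrable (fun s ↦ Real.exp (a * s) * g s) volume (z - τ) z :=
    Continuous.intervalIntegrable (by fun_prop) _ _
  simp only [periodicResolvent, Pi.sub_apply, mul_sub]
  rw [intervalIntegral.integral_sub (hc hg₁) (hc hg₂)]
  ring

theorem abs_periodicResolvent_le (ha : 0 < a) (hτ : 0 < τ) (hM : ∀ z, |g z| ≤ M) (z : ℝ) :
    |periodicResolvent τ a g z| ≤ (1 - Real.exp (-(a * τ)))⁻¹ * (M * τ) := by
  have hM0 : 0 ≤ M := (abs_nonneg _).trans (hM 0)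
  have h1 : 0 < 1 - Real.exp (-(a * τ)) := by
    have : Real.exp (-(a * τ)) < 1 := Real.exp_lt_one_iff.2 (by nlinarith)
    linarith
  have h2 : |∫ s in (z - τ)..z, Real.exp (a * s) * g s| ≤ Real.exp (a * z) * M * τ := by
    rw [← Real.norm_eq_abs]
    refine (intervalIntegral.norm_integral_le_of_norm_le_const (C := Real.exp (a * z) * M)
      fun s hs ↦ ?_).trans ?_
    · rw [uIoc_of_le (by linarith)] at hs
      rw [norm_mul, Real.norm_of_nonneg (Real.exp_pos _).le]
      have : Real.exp (a * s) ≤ Real.exp (a * z) := Real.exp_le_exp.2 (by nlinarith [hs.2])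
      exact mul_le_mul this (hM s) (abs_nonneg _) (Real.exp_pos _).le
    · rw [sub_sub_cancel, abs_of_pos hτ]
  rw [periodicResolvent, abs_mul, abs_mul, abs_of_pos (inv_pos.2 h1), Real.abs_exp]
  refine mul_le_mul_of_nonneg_left ?_ (inv_pos.2 h1).le
  calc Real.exp (-(a * z)) * |∫ s in (z - τ)..z, Real.exp (a * s) * g s|
      ≤ Real.exp (-(a * z)) * (Real.exp (a * z) * M * τ) :=
        mul_le_mul_of_nonneg_left h2 (Real.exp_pos _).le
    _ = M * τ := by
        have : Real.exp (-(a * z)) * Real.exp (a * z) = 1 := by rw [← Real.exp_add]; simp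
        linear_combination M * τ * this

end

/-- The right-hand side of the equation `u'' + a u' = wffForcing b κ h u`. -/
noncomputable def wffForcing (b κ h : ℝ) (u : ℝ → ℝ) (z : ℝ) : ℝ :=
  b * ((1 / (2 * π)) * ∫ s in (0 : ℝ)..(2 * π), Real.sin (s + u s)) - b * Real.sin (z + u z) +
    κ * (u (z + h) - 2 * u z + u (z - h))

section

variable {b κ h M : ℝ} {u v : ℝ → ℝ}

theorem continuous_wffForcing (hu : Continuous u) : Continuous (wffForcing b κ h u) := by
  unfold wffForcing
  fun_prop

theorem periodic_wffForcing (hu : Function.Periodic u (2 * π)) :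
    Function.Periodic (wffForcing b κ h u) (2 * π) := by
  intro z
  have h1 : u (z + 2 * π + h) = u (z + h) := by rw [add_right_comm, hu]
  have h2 : u (z + 2 * π - h) = u (z - h) := by rw [add_sub_right_comm, hu]
  have h3 : Real.sin (z + 2 * π + u z) = Real.sin (z + u z) := by
    rw [add_right_comm, Real.sin_add_two_pi]
  simp only [wffForcing, h1, h2, hu z, h3]

theorem Function.Periodic.intervalIntegral_comp_add_right {f : ℝ → ℝ} {τ : ℝ}
    (hf : Function.Periodic f τ) (c : ℝ) :
    ∫ z in (0 : ℝ)..τ, f (z + c) = ∫ z in (0 : ℝ)..τ, f z := by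
  rw [intervalIntegral.integral_comp_add_right, zero_add, add_comm τ c,
    hf.intervalIntegral_add_eq c 0, zero_add]

theorem integral_wffForcing (hu : Continuous u) (hper : Function.Periodic u (2 * π)) :
    ∫ z in (0 : ℝ)..(2 * π), wffForcing b κ h u z = 0 := by
  have h1 := hper.intervalIntegral_comp_add_right h
  have h2 := hper.intervalIntegral_comp_add_right (-h)
  simp only [← sub_eq_add_neg] at h2
  have hi {f : ℝ → ℝ} (hf : Continuous f) : IntervalIntegrable f volume 0 (2 * π) :=
    hf.intervalIntegrable _ _
  simp only [wffForcing]
  rw [intervalIntegral.integral_add (hi (by fun_prop)) (hi (by fun_prop)),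
    intervalIntegral.integral_sub (hi (by fun_prop)) (hi (by fun_prop)),
    intervalIntegral.integral_const, intervalIntegral.integral_const_mul b,
    intervalIntegral.integral_const_mul κ,
    intervalIntegral.integral_add (hi (by fun_prop)) (hi (by fun_prop)),
    intervalIntegral.integral_sub (hi (by fun_prop)) (hi (by fun_prop)),
    intervalIntegral.integral_const_mul, h1, h2, smul_eq_mul]
  have := Real.pi_ne_zero
  field_simp
  ring

theorem abs_average_le {f : ℝ → ℝ} (hM : ∀ z, |f z| ≤ M) :
    |(1 / (2 * π)) * ∫ s in (0 : ℝ)..(2 * π), f s| ≤ M := by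
  have h1 : |∫ s in (0 : ℝ)..(2 * π), f s| ≤ M * |2 * π - 0| := by
    rw [← Real.norm_eq_abs]
    exact intervalIntegral.norm_integral_le_of_norm_le_const fun s _ ↦ hM s
  rw [sub_zero, abs_of_pos Real.two_pi_pos] at h1
  rw [abs_mul, abs_of_pos (by positivity), one_div, inv_mul_le_iff₀ Real.two_pi_pos]
  linarith

theorem abs_wffForcing_le (hb : 0 ≤ b) (hκ : 0 ≤ κ) (hM : ∀ z, |u z| ≤ M) (z : ℝ) :
    |wffForcing b κ h u z| ≤ 2 * b + 4 * κ * M := by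
  have h1 := abs_le.1 (abs_average_le fun s ↦ Real.abs_sin_le_one (s + u s))
  have h2 := abs_le.1 (Real.abs_sin_le_one (z + u z))
  have h3 := abs_le.1 (hM (z + h))
  have h4 := abs_le.1 (hM z)
  have h5 := abs_le.1 (hM (z - h))
  unfold wffForcing
  rw [abs_le]
  constructor <;> nlinarith

theorem abs_wffForcing_sub_le (hb : 0 ≤ b) (hκ : 0 ≤ κ) (hu : Continuous u) (hv : Continuous v)
    (hM : ∀ z, |u z - v z| ≤ M) (z : ℝ) :
    |wffForcing b κ h u z - wffForcing b κ h v z| ≤ (2 * b + 4 * κ) * M := by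
  have hsin (z : ℝ) : |Real.sin (z + u z) - Real.sin (z + v z)| ≤ M := by
    have := Real.lipschitzWith_sin.dist_le_mul (z + u z) (z + v z)
    rw [Real.dist_eq, Real.dist_eq, add_sub_add_left_eq_sub, NNReal.coe_one, one_mul] at this
    exact this.trans (hM z)
  have h1 := abs_average_le hsin
  rw [intervalIntegral.integral_sub (Continuous.intervalIntegrable (by fun_prop) _ _)
    (Continuous.intervalIntegrable (by fun_prop) _ _), mul_sub] at h1
  replace h1 := abs_le.1 h1
  have h2 := abs_le.1 (hsin z)
  have h3 := abs_le.1 (hM (z + h))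
  have h4 := abs_le.1 (hM z)
  have h5 := abs_le.1 (hM (z - h))
  unfold wffForcing
  rw [abs_le]
  constructor <;> nlinarith

theorem integral_deriv_sq_le_of_wffForcing {a s : ℝ} {u' u'' : ℝ → ℝ} (hb : 0 ≤ b)
    (hs : s ∈ Icc (0 : ℝ) 1)
    (hu : ∀ z, HasDerivAt u (u' z) z) (hu' : ∀ z, HasDerivAt u' (u'' z) z)
    (hu'' : Continuous u'') (hper : Function.Periodic u (2 * π))
    (hper' : Function.Periodic u' (2 * π))
    (heq : ∀ z, u'' z + a * u' z = s * wffForcing b κ h u z) :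
    a * ∫ z in (0 : ℝ)..(2 * π), u' z ^ 2 ≤ b * (2 * π) := by
  have hc : Continuous u := continuous_iff_continuousAt.2 fun z ↦ (hu z).continuousAt
  have hc' : Continuous u' := continuous_iff_continuousAt.2 fun z ↦ (hu' z).continuousAt
  have hi {f : ℝ → ℝ} (hf : Continuous f) : IntervalIntegrable f volume 0 (2 * π) :=
    hf.intervalIntegrable _ _
  have hftc {f f' : ℝ → ℝ} (hf : ∀ z, HasDerivAt f (f' z) z) (hf' : Continuous f')
      (hp : f (2 * π) = f 0) : ∫ z in (0 : ℝ)..(2 * π), f' z = 0 := by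
    rw [intervalIntegral.integral_eq_sub_of_hasDerivAt (fun z _ ↦ hf z) (hi hf'), hp, sub_self]
  have e1 : ∫ z in (0 : ℝ)..(2 * π), u'' z * u' z = 0 := by
    have := hftc (fun z ↦ (hu' z).mul (hu' z)) (by fun_prop)
      (by simp only [Pi.mul_apply, hper'.eq])
    rw [intervalIntegral.integral_add (hi (by fun_prop)) (hi (by fun_prop))] at this
    simp only [mul_comm (u' _) (u'' _)] at this
    linarith
  have e2 : ∫ z in (0 : ℝ)..(2 * π), u' z = 0 := hftc hu hc' hper.eq
  have e3 : ∫ z in (0 : ℝ)..(2 * π), u z * u' z = 0 := by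
    have := hftc (fun z ↦ (hu z).mul (hu z)) (by fun_prop) (by simp only [Pi.mul_apply, hper.eq])
    rw [intervalIntegral.integral_add (hi (by fun_prop)) (hi (by fun_prop))] at this
    simp only [mul_comm (u' _) (u _)] at this
    linarith
  have e4 : (∫ z in (0 : ℝ)..(2 * π), u (z + h) * u' z) +
      ∫ z in (0 : ℝ)..(2 * π), u (z - h) * u' z = 0 := by
    have h1 := hftc (fun z ↦ ((hu (z + h)).comp_add_const z h).mul (hu z)) (by fun_prop) (by
      have := hper h
      rw [add_comm] at this
      simp only [Pi.mul_apply, hper.eq, zero_add, this])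
    have h2 : Function.Periodic (fun z ↦ u (z - h) * u' z) (2 * π) := fun z ↦ by
      simp only [hper' z]
      rw [add_sub_right_comm, hper]
    have h3 := h2.intervalIntegral_comp_add_right h
    simp only [add_sub_cancel_right] at h3
    rw [intervalIntegral.integral_add (hi (by fun_prop)) (hi (by fun_prop))] at h1
    simp only [mul_comm (u' _) (u _)] at h1
    linarith
  have e5 : (∫ z in (0 : ℝ)..(2 * π), Real.sin (z + u z) * u' z) =
      -∫ z in (0 : ℝ)..(2 * π), Real.sin (z + u z) := by
    have h1 := hftc (fun z ↦ (((hasDerivAt_id z).add (hu z)).cos)) (by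
      simp only [id, Pi.add_apply]; fun_prop) (by
        simp only [Pi.add_apply, id, hper.eq, zero_add]
        rw [add_comm, Real.cos_add_two_pi])
    have h2 : ∀ z, -Real.sin ((id + u : ℝ → ℝ) z) * (1 + u' z) =
        -(Real.sin (z + u z) + Real.sin (z + u z) * u' z) := fun z ↦ by
      simp only [Pi.add_apply, id]; ring
    simp only [h2] at h1
    rw [intervalIntegral.integral_neg,
      intervalIntegral.integral_add (hi (by fun_prop)) (hi (by fun_prop))] at h1
    linarith
  set m := (1 / (2 * π)) * ∫ s in (0 : ℝ)..(2 * π), Real.sin (s + u s) with hm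
  have e6 : ∫ z in (0 : ℝ)..(2 * π), a * u' z ^ 2 =
      ∫ z in (0 : ℝ)..(2 * π), (-(u'' z * u' z) + s * b * m * u' z
        - s * b * (Real.sin (z + u z) * u' z) + s * κ * (u (z + h) * u' z)
        - 2 * s * κ * (u z * u' z) + s * κ * (u (z - h) * u' z)) := by
    refine intervalIntegral.integral_congr fun z _ ↦ ?_
    have := heq z
    rw [wffForcing, ← hm] at this
    linear_combination u' z * this
  rw [intervalIntegral.integral_add (hi (by fun_prop)) (hi (by fun_prop)),
    intervalIntegral.integral_sub (hi (by fun_prop)) (hi (by fun_prop)),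
    intervalIntegral.integral_add (hi (by fun_prop)) (hi (by fun_prop)),
    intervalIntegral.integral_sub (hi (by fun_prop)) (hi (by fun_prop)),
    intervalIntegral.integral_add (hi (by fun_prop)) (hi (by fun_prop)),
    intervalIntegral.integral_neg] at e6
  simp only [intervalIntegral.integral_const_mul] at e6
  rw [e1, e2, e3, e5] at e6
  have e7 : a * ∫ z in (0 : ℝ)..(2 * π), u' z ^ 2 =
      s * b * ∫ z in (0 : ℝ)..(2 * π), Real.sin (z + u z) := by
    linear_combination e6 + s * κ * e4
  have e8 : |∫ z in (0 : ℝ)..(2 * π), Real.sin (z + u z)| ≤ 1 * |2 * π - 0| := by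
    rw [← Real.norm_eq_abs]
    exact intervalIntegral.norm_integral_le_of_norm_le_const fun z _ ↦ Real.abs_sin_le_one _
  rw [sub_zero, abs_of_pos Real.two_pi_pos, one_mul] at e8
  rw [e7]
  calc s * b * ∫ z in (0 : ℝ)..(2 * π), Real.sin (z + u z)
      ≤ s * b * (2 * π) :=
        mul_le_mul_of_nonneg_left ((le_abs_self _).trans e8) (mul_nonneg hs.1 hb)
    _ ≤ b * (2 * π) := by
        gcongr
        exact mul_le_of_le_one_left hb hs.2

end

theorem abs_le_of_integral_deriv_sq_le {τ D : ℝ} (hτ : 0 < τ) {u u' : ℝ → ℝ}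
    (hu : ∀ z, HasDerivAt u (u' z) z) (hu' : Continuous u') (hper : Function.Periodic u τ)
    (hmean : ∫ z in (0 : ℝ)..τ, u z = 0) (hD : ∫ z in (0 : ℝ)..τ, u' z ^ 2 ≤ D) (z : ℝ) :
    |u z| ≤ τ + D := by
  have hc : Continuous u := continuous_iff_continuousAt.2 fun z ↦ (hu z).continuousAt
  have key : ∀ x ∈ Icc 0 τ, ∀ y ∈ Icc 0 τ, x ≤ y → |u y - u x| ≤ τ + D := by
    intro x hx y hy hxy
    rw [← intervalIntegral.integral_eq_sub_of_hasDerivAt (fun z _ ↦ hu z)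
      (hu'.intervalIntegrable x y)]
    calc |∫ z in x..y, u' z| ≤ ∫ z in x..y, |u' z| :=
          intervalIntegral.abs_integral_le_integral_abs hxy
      _ ≤ ∫ z in (0 : ℝ)..τ, |u' z| :=
          intervalIntegral.integral_mono_interval hx.1 hxy hy.2
            (Filter.Eventually.of_forall fun z ↦ abs_nonneg _)
            (hu'.abs.intervalIntegrable _ _)
      _ ≤ ∫ z in (0 : ℝ)..τ, (1 + u' z ^ 2) :=
          intervalIntegral.integral_mono_on hτ.le (hu'.abs.intervalIntegrable _ _)
            (Continuous.intervalIntegrable (by fun_prop) _ _) fun z _ ↦ by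
              nlinarith [sq_abs (u' z), sq_nonneg (|u' z| - 1), sq_nonneg (|u' z|)]
      _ = τ + ∫ z in (0 : ℝ)..τ, u' z ^ 2 := by
          rw [intervalIntegral.integral_add (Continuous.intervalIntegrable (by fun_prop) _ _)
            (Continuous.intervalIntegrable (by fun_prop) _ _)]
          simp
      _ ≤ τ + D := by linarith
  have key' : ∀ x ∈ Icc 0 τ, ∀ y ∈ Icc 0 τ, |u y - u x| ≤ τ + D := fun x hx y hy ↦ by
    rcases le_total x y with hxy | hxy
    · exact key x hx y hy hxy
    · rw [abs_sub_comm]; exact key y hy x hx hxy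
  obtain ⟨y, hy, hzy⟩ := hper.exists_mem_Ico₀ hτ z
  have h1 : ‖∫ x in (0 : ℝ)..τ, (u y - u x)‖ ≤ (τ + D) * |τ - 0| := by
    refine intervalIntegral.norm_integral_le_of_norm_le_const fun x hx ↦ ?_
    rw [uIoc_of_le hτ.le] at hx
    exact key' x (Ioc_subset_Icc_self hx) y (Ico_subset_Icc_self hy)
  rw [intervalIntegral.integral_sub intervalIntegrable_const (hc.intervalIntegrable _ _), hmean,
    intervalIntegral.integral_const, sub_zero, sub_zero, smul_eq_mul, Real.norm_eq_abs, abs_mul,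
    abs_of_pos hτ, mul_comm] at h1
  rw [hzy]
  exact le_of_mul_le_mul_right h1 hτ

/-- For every value `λ > 0` there exists a solution of equation (wff) with
parameter `λ`. -/
theorem exists_wffSolution (n m : ℕ) (hn : 1 ≤ n) (hm : 1 ≤ m)
    (Γ K lam : ℝ) (hΓ : 0 < Γ) (hK : 0 < K) (hlam : 0 < lam) :
    ∃ u : ℝ → ℝ, WffSolution n m Γ K lam u := by
  have hτ := Real.two_pi_pos
  have : Fact (0 < 2 * π) := ⟨hτ⟩
  set a := lam * Γ with ha_def
  set b := lam ^ 2 with hb_def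
  set κ := lam ^ 2 * K with hκ_def
  set h := 2 * π * m / n with hh_def
  have ha : 0 < a := mul_pos hlam hΓ
  have hb : 0 ≤ b := sq_nonneg _
  have hκ : 0 ≤ κ := mul_nonneg hb hK.le
  let X := BoundedContinuousFunction (AddCircle (2 * π)) ℝ
  let lift : X → ℝ → ℝ := fun u z ↦ u z
  have hlc (u : X) : Continuous (lift u) := u.continuous.comp (AddCircle.continuous_mk' _)
  have hlp (u : X) : Function.Periodic (lift u) (2 * π) := fun z ↦ by
    simp only [lift, AddCircle.coe_add_period]
  let N : X → ℝ → ℝ := fun u ↦ wffForcing b κ h (lift u)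
  have hNc (u : X) : Continuous (N u) := continuous_wffForcing (hlc u)
  have hNp (u : X) : Function.Periodic (N u) (2 * π) := periodic_wffForcing (hlp u)
  have hNm (u : X) : ∫ z in (0 : ℝ)..(2 * π), N u z = 0 := integral_wffForcing (hlc u) (hlp u)
  let P : X → ℝ → ℝ := fun u ↦ zeroMeanPrimitive (2 * π) (N u)
  have hPd (u : X) (z : ℝ) : HasDerivAt (P u) (N u z) z := hasDerivAt_zeroMeanPrimitive (hNc u) z
  have hPc (u : X) : Continuous (P u) := continuous_zeroMeanPrimitive (hNc u)
  have hPp (u : X) : Function.Periodic (P u) (2 * π) :=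
    periodic_zeroMeanPrimitive (hNc u) (hNp u) (hNm u)
  have hPm (u : X) : ∫ z in (0 : ℝ)..(2 * π), P u z = 0 :=
    integral_zeroMeanPrimitive hτ (hNc u)
  let S : X → ℝ → ℝ := fun u ↦ periodicResolvent (2 * π) a (P u)
  have hSd (u : X) (z : ℝ) : HasDerivAt (S u) (P u z - a * S u z) z :=
    hasDerivAt_periodicResolvent ha hτ (hPc u) (hPp u) z
  have hSc (u : X) : Continuous (S u) := continuous_periodicResolvent ha hτ (hPc u) (hPp u)
  have hSp (u : X) : Function.Periodic (S u) (2 * π) := periodic_periodicResolvent (hPp u)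
  have hSm (u : X) : ∫ z in (0 : ℝ)..(2 * π), S u z = 0 :=
    integral_periodicResolvent ha hτ (hPc u) (hPp u) (hPm u)
  have hSdd (u : X) (z : ℝ) :
      HasDerivAt (fun z ↦ P u z - a * S u z) (N u z - a * (P u z - a * S u z)) z :=
    (hPd u z).sub ((hSd u z).const_mul a)
  choose T hT using fun u ↦ exists_boundedContinuousFunction_addCircle (hSc u) (hSp u)
  set c := (1 - Real.exp (-(a * (2 * π))))⁻¹ with hc_def
  have hTcont : Continuous T := by
    refine (LipschitzWith.of_dist_le_mul (K := Real.toNNReal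
      (c * (2 * (2 * π) * (2 * b + 4 * κ) * (2 * π)))) fun u v ↦ ?_).continuous
    refine (BoundedContinuousFunction.dist_le (by positivity)).2 fun x ↦ ?_
    induction x using QuotientAddGroup.induction_on with | H z =>
    rw [hT, hT, Real.dist_eq, ← periodicResolvent_sub (hPc u) (hPc v)]
    have h1 (z : ℝ) : |(N u - N v) z| ≤ (2 * b + 4 * κ) * dist u v :=
      abs_wffForcing_sub_le hb hκ (hlc u) (hlc v)
        (fun z ↦ BoundedContinuousFunction.dist_coe_le_dist (f := u) (g := v) z) z
    have h2 (z : ℝ) : |(P u - P v) z| ≤ 2 * (2 * π) * ((2 * b + 4 * κ) * dist u v) := by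
      rw [Pi.sub_apply, ← zeroMeanPrimitive_sub (hNc u) (hNc v)]
      refine abs_zeroMeanPrimitive_le hτ ((hNc u).sub (hNc v)) ((hNp u).sub (hNp v)) ?_ h1 z
      rw [Pi.sub_def, intervalIntegral.integral_sub ((hNc u).intervalIntegrable _ _)
        ((hNc v).intervalIntegrable _ _), hNm, hNm, sub_self]
    refine (abs_periodicResolvent_le ha hτ h2 z).trans ?_
    calc c * (2 * (2 * π) * ((2 * b + 4 * κ) * dist u v) * (2 * π))
        = c * (2 * (2 * π) * (2 * b + 4 * κ) * (2 * π)) * dist u v := by ring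
      _ ≤ _ := mul_le_mul_of_nonneg_right (Real.le_coe_toNNReal _) dist_nonneg
  set D := b * (2 * π) / a with hD_def
  have hD : 0 ≤ D := by positivity
  set R := 2 * π + D + 1 with hR_def
  have hR : 0 < R := by positivity
  set M₁ := 2 * (2 * π) * (2 * b + 4 * κ * R) with hM₁_def
  set M₂ := c * (M₁ * (2 * π)) with hM₂_def
  have hP_le (u : X) (hu : ‖u‖ ≤ R) (z : ℝ) : |P u z| ≤ M₁ :=
    abs_zeroMeanPrimitive_le hτ (hNc u) (hNp u) (hNm u)
      (abs_wffForcing_le hb hκ fun z ↦ (u.norm_coe_le_norm z).trans hu) z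
  have hS_le (u : X) (hu : ‖u‖ ≤ R) (z : ℝ) : |S u z| ≤ M₂ :=
    abs_periodicResolvent_le ha hτ (hP_le u hu) z
  obtain ⟨u, hu⟩ := exists_isFixedPt_of_forall_eq_smul_norm_lt hTcont hR
    (isCompact_closure_setOf_lipschitz_addCircle M₂ (M₁ + a * M₂)) (fun u hu ↦ by
      refine subset_closure ⟨fun x ↦ ?_, fun x y ↦ ?_⟩
      · induction x using QuotientAddGroup.induction_on with | H z =>
        rw [hT]
        exact hS_le u hu z
      · rw [hT, hT]
        refine convex_univ.norm_image_sub_le_of_norm_hasDerivWithin_le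
          (fun z _ ↦ (hSd u z).hasDerivWithinAt) (fun z _ ↦ ?_) (mem_univ y) (mem_univ x)
        refine (abs_sub _ _).trans (add_le_add (hP_le u hu z) ?_)
        rw [abs_mul, abs_of_pos ha]
        exact mul_le_mul_of_nonneg_left (hS_le u hu z) ha.le) (fun s hs u hu ↦ by
    have hlift : lift u = fun z ↦ s * S u z := by
      ext z
      rw [← hT]
      exact congrArg (fun w : X ↦ w (z : AddCircle (2 * π))) hu
    have hd (z : ℝ) : HasDerivAt (lift u) (s * (P u z - a * S u z)) z := by
      rw [hlift]; exact (hSd u z).const_mul s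
    have hdd (z : ℝ) : HasDerivAt (fun z ↦ s * (P u z - a * S u z))
        (s * (N u z - a * (P u z - a * S u z))) z := (hSdd u z).const_mul s
    have hNcu := hNc u
    have hPcu := hPc u
    have hScu := hSc u
    have h1 : a * ∫ z in (0 : ℝ)..(2 * π), (s * (P u z - a * S u z)) ^ 2 ≤ b * (2 * π) :=
      integral_deriv_sq_le_of_wffForcing (κ := κ) (h := h) hb hs hd hdd (by fun_prop) (hlp u)
        (fun z ↦ by simp only [hPp u z, hSp u z]) (fun z ↦ by simp only [N]; ring)
    have h2 (z : ℝ) : |lift u z| ≤ 2 * π + D := by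
      have hmean : ∫ z in (0 : ℝ)..(2 * π), lift u z = 0 := by
        rw [hlift, intervalIntegral.integral_const_mul, hSm, mul_zero]
      refine abs_le_of_integral_deriv_sq_le hτ hd (by fun_prop) (hlp u) hmean ?_ z
      rw [hD_def, le_div_iff₀ ha]; linarith
    refine lt_of_le_of_lt ((BoundedContinuousFunction.norm_le (by positivity)).2 fun x ↦ ?_)
      (lt_add_one (2 * π + D))
    induction x using QuotientAddGroup.induction_on with | H z =>
    exact h2 z)
  have hlift : lift u = S u := by
    ext z
    simp only [lift]
    conv_lhs => rw [← hu]
    exact hT u z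
  have hderiv : deriv (S u) = fun z ↦ P u z - a * S u z := funext fun z ↦ (hSd u z).deriv
  have hderiv2 : deriv (deriv (S u)) = fun z ↦ N u z - a * (P u z - a * S u z) := by
    rw [hderiv]; exact funext fun z ↦ (hSdd u z).deriv
  refine ⟨S u, ?_, hSp u, hSm u, fun z ↦ ?_⟩
  · have hNcu := hNc u
    have hPcu := hPc u
    have hScu := hSc u
    rw [show (2 : WithTop ℕ∞) = 1 + 1 by norm_num, contDiff_succ_iff_deriv]
    refine ⟨fun z ↦ (hSd u z).differentiableAt, by simp, ?_⟩
    rw [contDiff_one_iff_deriv, hderiv2]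
    refine ⟨?_, by fun_prop⟩
    rw [hderiv]
    exact fun z ↦ (hSdd u z).differentiableAt
  · rw [hderiv2, hderiv]
    simp only [N, wffForcing, hlift]
    rw [← ha_def, ← hh_def, ← hκ_def, ← hb_def]
    ring
end

section
/- If f is the waveform of a travelling wave of the discrete sine-Gordon ring with period T > 0 (so f(t + T) = f(t) + 2π for all t and f satisfies the waveform equation), then F · T = 2πΓ + ∫₀^T sin(f(t)) dt. -/
/-- The second difference of a quasi-periodic function integrates to zero over a period. -/
lemma intervalIntegral_second_difference_eq_zero {f : ℝ → ℝ} {T c : ℝ} (hf : Continuous f)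
    (hper : ∀ t, f (t + T) = f t + c) (a : ℝ) :
    ∫ t in (0:ℝ)..T, (f (t + a) - 2 * f t + f (t - a)) = 0 := by
  set h : ℝ → ℝ := fun t => f (t + a) - f t with hh
  have hc : Continuous h := by fun_prop
  have hp : Function.Periodic h T := fun t => by
    simp only [hh, add_right_comm t T a, hper]
    ring
  have heq : ∀ t, f (t + a) - 2 * f t + f (t - a) = h t - h (t - a) := fun t => by
    simp only [hh, sub_add_cancel]
    ring
  have hshift : ∫ t in (0:ℝ)..T, h (t - a) = ∫ t in (0:ℝ)..T, h t := by
    rw [intervalIntegral.integral_comp_sub_right h a]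
    convert hp.intervalIntegral_add_eq (0 - a) 0 using 2 <;> ring
  simp only [heq]
  rw [intervalIntegral.integral_sub (hc.intervalIntegrable _ _)
    (Continuous.intervalIntegrable (by fun_prop) _ _), hshift, sub_self]

open Real in
/-- If `f` is the waveform of a travelling wave with period `T > 0`, then
`F·T = 2πΓ + ∫₀^T sin(f(t)) dt`. -/
theorem force_eq_of_waveform (n m : ℕ) (hn : 1 ≤ n) (hm : 1 ≤ m)
    (Γ K F T : ℝ) (hΓ : 0 < Γ) (hK : 0 < K) (hF : 0 < F) (hT : 0 < T)
    (f : ℝ → ℝ) (hf : IsWaveform n m Γ K F (2 * π / T) f) :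
    F * T = 2 * π * Γ + ∫ t in (0:ℝ)..T, Real.sin (f t) := by
  obtain ⟨hC, hper, hwave⟩ := hf
  have hTT : 2 * π / (2 * π / T) = T := by
    field_simp
  rw [hTT] at hper hwave
  have hf : Continuous f := hC.continuous
  have hC' : ContDiff ℝ 1 (deriv f) :=
    ContDiff.deriv' (n := 1) (by simpa [one_add_one_eq_two] using hC)
  have hf' : Continuous (deriv f) := hC'.continuous
  have hf'' : Continuous (deriv (deriv f)) := hC'.continuous_deriv le_rfl
  have hper' : deriv f T = deriv f 0 := by
    have h := deriv_comp_add_const f T 0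
    rw [funext hper, deriv_add_const, zero_add] at h
    exact h.symm
  have hint' : ∫ t in (0:ℝ)..T, deriv f t = 2 * π := by
    rw [intervalIntegral.integral_deriv_eq_sub (fun t _ => hC.differentiable (by norm_num) t)
      (hf'.intervalIntegrable _ _)]
    have h := hper 0
    rw [zero_add] at h
    rw [h]
    ring
  have hint'' : ∫ t in (0:ℝ)..T, deriv (deriv f) t = 0 := by
    rw [intervalIntegral.integral_deriv_eq_sub (fun t _ => hC'.differentiable (by norm_num) t)
      (hf''.intervalIntegrable _ _), hper', sub_self]
  have hint := intervalIntegral.integral_congr (μ := MeasureTheory.volume) (a := 0) (b := T)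
    (fun t _ => hwave t)
  rw [intervalIntegral.integral_add (Continuous.intervalIntegrable (by fun_prop) _ _)
      (Continuous.intervalIntegrable (by fun_prop) _ _),
    intervalIntegral.integral_add (Continuous.intervalIntegrable (by fun_prop) _ _)
      (Continuous.intervalIntegrable (by fun_prop) _ _),
    intervalIntegral.integral_add (Continuous.intervalIntegrable (by fun_prop) _ _)
      (Continuous.intervalIntegrable (by fun_prop) _ _),
    intervalIntegral.integral_const_mul, intervalIntegral.integral_const_mul,
    intervalIntegral_second_difference_eq_zero hf hper, hint', hint'',
    intervalIntegral.integral_const, smul_eq_mul] at hint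
  linarith
end

section
/- Let λ > 0 and let u be a solution of equation (wff) with parameter λ. Then 0 < (1/(2π)) ∫₀^{2π} sin(s + u(s)) ds < 1; equivalently, the functional Φ(λ,u) = Γ/λ + (1/(2π)) ∫₀^{2π} sin(s + u(s)) ds satisfies Γ/λ < Φ(λ,u) < Γ/λ + 1. -/
section PeriodicFunctions

open Real

/-- The product of a delayed periodic function with the derivative has the same integral as its
translate over a period. -/
lemma integral_shift_mul_deriv_sub_eq_zero {u : ℝ → ℝ} {T : ℝ} (hu : ContDiff ℝ 1 u)
    (hper : Function.Periodic u T) (a : ℝ) :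
    ∫ z in (0:ℝ)..T, (u (z - a) * deriv u z - u z * deriv u (z + a)) = 0 := by
  have hc : Continuous u := hu.continuous
  have hc' : Continuous (deriv u) := hu.continuous_deriv le_rfl
  have hp : Function.Periodic (fun z => u (z - a) * deriv u z) T := by
    intro z
    have h : deriv u (z + T) = deriv u z := by
      rw [← deriv_comp_add_const, funext hper]
    simp only [h, add_sub_right_comm z T a, hper (z - a)]
  have hshift : ∫ z in (0:ℝ)..T, u z * deriv u (z + a)
      = ∫ z in (0:ℝ)..T, u (z - a) * deriv u z := by
    have h := intervalIntegral.integral_comp_add_right (a := 0) (b := T)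
      (fun z => u (z - a) * deriv u z) a
    simp only [add_sub_cancel_right] at h
    rw [h, zero_add, add_comm T a, hp.intervalIntegral_add_eq a 0, zero_add]
  rw [intervalIntegral.integral_sub, hshift, sub_self] <;>
    exact Continuous.intervalIntegrable (by fun_prop) _ _

/-- The sine of a continuous lift of a degree one circle map has mean less than one. -/
lemma integral_sin_add_lt_two_pi {u : ℝ → ℝ} (hc : Continuous u)
    (hper : Function.Periodic u (2 * π)) :
    ∫ s in (0:ℝ)..(2 * π), sin (s + u s) < 2 * π := by
  have hπ := pi_pos
  obtain ⟨c, hc01, hlt⟩ : ∃ c ∈ Set.Icc (0:ℝ) (2 * π), sin (c + u c) < 1 := by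
    obtain h | h := lt_or_ge (sin (u 0)) 1
    · exact ⟨0, ⟨le_rfl, by positivity⟩, by simpa using h⟩
    · have hu : u (2 * π) = u 0 := by simpa using hper 0
      obtain ⟨c, hc01, hcv⟩ := intermediate_value_Icc (by positivity : (0:ℝ) ≤ 2 * π)
        (f := fun s => s + u s) (by fun_prop)
        (show u 0 + π ∈ _ from ⟨by linarith, by simp only [hu]; linarith⟩)
      refine ⟨c, hc01, ?_⟩
      simp only at hcv
      rw [hcv, sin_add_pi]
      linarith
  have h := intervalIntegral.integral_lt_integral_of_continuousOn_of_le_of_exists_lt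
    (f := fun s => sin (s + u s)) (g := fun _ => (1:ℝ)) (by positivity : (0:ℝ) < 2 * π)
    (by fun_prop) (by fun_prop) (fun s _ => sin_le_one _) ⟨c, hc01, hlt⟩
  simpa using h

end PeriodicFunctions

namespace WffSolution

open Real

variable {n m : ℕ} {Γ K lam : ℝ} {u : ℝ → ℝ}

/-- The energy balance, obtained by testing the equation against the derivative. -/
lemma energy_balance (hu : WffSolution n m Γ K lam u) :
    lam * Γ * ∫ z in (0:ℝ)..(2 * π), deriv u z ^ 2
      = lam ^ 2 * ∫ z in (0:ℝ)..(2 * π), sin (z + u z) := by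
  obtain ⟨hC, hper, -, heq⟩ := hu
  set J := ∫ s in (0:ℝ)..(2 * π), sin (s + u s) with hJ
  set a : ℝ := 2 * π * m / n
  have hC1 : ContDiff ℝ 1 u := hC.of_le (by norm_num)
  have hC' : ContDiff ℝ 1 (deriv u) := hC.deriv' (n := 1)
  have hc : Continuous u := hC.continuous
  have hc' : Continuous (deriv u) := hC'.continuous
  have hd (z : ℝ) : HasDerivAt u (deriv u z) z :=
    (hC1.differentiable (by norm_num) z).hasDerivAt
  have hd' (z : ℝ) : HasDerivAt (deriv u) (deriv (deriv u) z) z :=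
    (hC'.differentiable (by norm_num) z).hasDerivAt
  have hper' (z : ℝ) : deriv u (z + 2 * π) = deriv u z := by
    rw [← deriv_comp_add_const, funext hper]
  have hF (z : ℝ) : HasDerivAt (fun z => -(deriv u z ^ 2) / 2 + lam ^ 2 * cos (z + u z)
        + lam ^ 2 * (1 / (2 * π)) * J * u z + lam ^ 2 * K * (u z * u (z + a) - u z ^ 2))
      (lam * Γ * deriv u z ^ 2 - lam ^ 2 * sin (z + u z)
        - lam ^ 2 * K * (u (z - a) * deriv u z - u z * deriv u (z + a))) z := by
    have h := (((((hd' z).pow 2).neg.div_const 2).add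
      (((hasDerivAt_id z).add (hd z)).cos.const_mul (lam ^ 2))).add
      ((hd z).const_mul (lam ^ 2 * (1 / (2 * π)) * J))).add
      ((((hd z).mul ((hd (z + a)).comp_add_const z a)).sub ((hd z).pow 2)).const_mul (lam ^ 2 * K))
    refine h.congr_deriv ?_
    simp only [id, Pi.add_apply]
    push_cast
    linear_combination (-deriv u z) * heq z
  have hint := intervalIntegral.integral_eq_sub_of_hasDerivAt (a := 0) (b := 2 * π)
    (fun z _ => hF z) (Continuous.intervalIntegrable (by fun_prop) _ _)
  have h0 : u (2 * π) = u 0 := by simpa using hper 0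
  have h0' : deriv u (2 * π) = deriv u 0 := by simpa using hper' 0
  have ha : u (2 * π + a) = u (0 + a) := by rw [add_comm, hper, zero_add]
  have hcos : cos (2 * π + u 0) = cos (0 + u 0) := by rw [add_comm, cos_add_two_pi, zero_add]
  rw [h0, h0', ha, hcos, sub_self, intervalIntegral.integral_sub, intervalIntegral.integral_sub,
    intervalIntegral.integral_const_mul, intervalIntegral.integral_const_mul,
    intervalIntegral.integral_const_mul, integral_shift_mul_deriv_sub_eq_zero hC1 hper a,
    ← hJ] at hint
  · linarith
  all_goals exact Continuous.intervalIntegrable (by fun_prop) _ _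

/-- A solution is not constant. -/
lemma exists_deriv_ne_zero (hlam : lam ≠ 0) (hu : WffSolution n m Γ K lam u) :
    ∃ z ∈ Set.Icc (0:ℝ) (2 * π), deriv u z ≠ 0 := by
  obtain ⟨hC, hper, -, heq⟩ := hu
  by_contra! h
  have hper' : Function.Periodic (deriv u) (2 * π) := fun z => by
    rw [← deriv_comp_add_const, funext hper]
  have hzero (z : ℝ) : deriv u z = 0 := by
    obtain ⟨y, hy, hzy⟩ := hper'.exists_mem_Ico₀ two_pi_pos z
    rw [hzy, h y ⟨hy.1, hy.2.le⟩]
  have hconst (z : ℝ) : u z = u 0 :=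
    is_const_of_deriv_eq_zero (hC.differentiable (by norm_num)) hzero z 0
  have hsin (z : ℝ) : sin (z + u 0) = sin (0 + u 0) := by
    have h1 := heq z
    have h2 := heq 0
    simp only [funext hzero, deriv_const, hconst] at h1 h2
    exact mul_left_cancel₀ (pow_ne_zero 2 hlam) (by linarith)
  have h1 := hsin π
  have h2 := hsin (π / 2)
  rw [add_comm, sin_add_pi, zero_add] at h1
  rw [add_comm, sin_add_pi_div_two, zero_add] at h2
  nlinarith [sin_sq_add_cos_sq (u 0)]

lemma integral_sin_pos (hΓ : 0 < Γ) (hlam : 0 < lam) (hu : WffSolution n m Γ K lam u) :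
    0 < ∫ s in (0:ℝ)..(2 * π), sin (s + u s) := by
  obtain ⟨c, hc, hne⟩ := hu.exists_deriv_ne_zero hlam.ne'
  have hcont : Continuous (deriv u) := hu.1.continuous_deriv (by norm_num)
  have hpos : 0 < ∫ z in (0:ℝ)..(2 * π), deriv u z ^ 2 :=
    intervalIntegral.integral_pos two_pi_pos (by fun_prop) (fun z _ => sq_nonneg _)
      ⟨c, hc, by positivity⟩
  refine pos_of_mul_pos_right (a := lam ^ 2) ?_ (by positivity)
  rw [← hu.energy_balance]
  positivity

end WffSolution

open Real in
/-- For any solution `u` of (wff) with parameter `λ > 0`, the mean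
`(1/2π)∫₀^{2π} sin(s+u(s)) ds` lies strictly between `0` and `1`; equivalently,
`Φ(λ,u) = Γ/λ + (1/2π)∫₀^{2π} sin(s+u(s)) ds` satisfies
`Γ/λ < Φ(λ,u) < Γ/λ + 1`. -/
theorem mean_sin_pos_lt_one (n m : ℕ) (hn : 1 ≤ n) (hm : 1 ≤ m)
    (Γ K lam : ℝ) (hΓ : 0 < Γ) (hK : 0 < K) (hlam : 0 < lam)
    (u : ℝ → ℝ) (hu : WffSolution n m Γ K lam u) :
    (0 < (1 / (2 * π)) * ∫ s in (0:ℝ)..(2 * π), Real.sin (s + u s) ∧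
      (1 / (2 * π)) * (∫ s in (0:ℝ)..(2 * π), Real.sin (s + u s)) < 1) ∧
    (Γ / lam < Γ / lam + (1 / (2 * π)) * ∫ s in (0:ℝ)..(2 * π), Real.sin (s + u s) ∧
      Γ / lam + (1 / (2 * π)) * (∫ s in (0:ℝ)..(2 * π), Real.sin (s + u s))
        < Γ / lam + 1) := by
  have hpos := hu.integral_sin_pos hΓ hlam
  have hlt := integral_sin_add_lt_two_pi hu.1.continuous hu.2.1
  have h0 : 0 < (1 / (2 * π)) * ∫ s in (0:ℝ)..(2 * π), Real.sin (s + u s) := by positivity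
  have h1 : (1 / (2 * π)) * (∫ s in (0:ℝ)..(2 * π), Real.sin (s + u s)) < 1 := by
    rw [one_div_mul_eq_div, div_lt_one two_pi_pos]
    exact hlt
  exact ⟨⟨h0, h1⟩, by linarith, by linarith⟩
end

section
/- Let λ > 0 and let u be a solution of equation (wff) with parameter λ. Then Γ · (1/(2π)) ∫₀^{2π} (u'(s))² ds = λ · (1/(2π)) ∫₀^{2π} sin(s + u(s)) ds. -/
/-- The integral over one period of the derivative of a periodic function vanishes. -/
theorem Function.Periodic.intervalIntegral_deriv_eq_zero {F F' : ℝ → ℝ} {T : ℝ}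
    (hF : Function.Periodic F T) (hd : ∀ z, HasDerivAt F (F' z) z) (hc : Continuous F') :
    ∫ z in (0:ℝ)..T, F' z = 0 := by
  rw [intervalIntegral.integral_eq_sub_of_hasDerivAt (fun z _ => hd z)
    (hc.intervalIntegrable _ _)]
  have h := hF 0
  rw [zero_add] at h
  rw [h, sub_self]

/-- The integral over one period is invariant under translation of a periodic integrand. -/
theorem Function.Periodic.intervalIntegral_comp_add {f : ℝ → ℝ} {T : ℝ}
    (hf : Function.Periodic f T) (a : ℝ) :
    ∫ z in (0:ℝ)..T, f (z + a) = ∫ z in (0:ℝ)..T, f z := by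
  rw [intervalIntegral.integral_comp_add_right]
  have h := hf.intervalIntegral_add_eq a 0
  rwa [zero_add, add_comm a T, ← zero_add a, ← add_assoc, add_zero] at h

/-- Derivative of a periodic function is periodic. -/
theorem Function.Periodic.deriv_real {f : ℝ → ℝ} {T : ℝ}
    (hf : Function.Periodic f T) : Function.Periodic (deriv f) T := fun z => by
  rw [← deriv_comp_add_const, show (fun x => f (x + T)) = f from funext hf]

open Real in
/-- Energy identity: for any solution `u` of (wff) with parameter `λ > 0`,
`Γ·(1/2π)∫₀^{2π} (u'(s))² ds = λ·(1/2π)∫₀^{2π} sin(s+u(s)) ds`. -/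
theorem energy_identity (n m : ℕ) (hn : 1 ≤ n) (hm : 1 ≤ m)
    (Γ K lam : ℝ) (hΓ : 0 < Γ) (hK : 0 < K) (hlam : 0 < lam)
    (u : ℝ → ℝ) (hu : WffSolution n m Γ K lam u) :
    Γ * ((1 / (2 * π)) * ∫ s in (0:ℝ)..(2 * π), (deriv u s) ^ 2)
      = lam * ((1 / (2 * π)) * ∫ s in (0:ℝ)..(2 * π), Real.sin (s + u s)) := by
  obtain ⟨hsmooth, hper, -, hode⟩ := hu
  replace hper : Function.Periodic u (2 * π) := hper
  have hper' := hper.deriv_real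
  set a : ℝ := 2 * π * m / n
  set C : ℝ := lam ^ 2 * (1 / (2 * π)) * ∫ s in (0:ℝ)..(2 * π), Real.sin (s + u s)
  have hsmooth' : ContDiff ℝ 1 (deriv u) := by
    have h : ContDiff ℝ (1 + 1) u := by simpa [one_add_one_eq_two] using hsmooth
    exact (contDiff_succ_iff_deriv.mp h).2.2
  have hc : Continuous u := hsmooth.continuous
  have hc' : Continuous (deriv u) := hsmooth'.continuous
  have hd (z : ℝ) : HasDerivAt u (deriv u z) z :=
    (hsmooth.differentiable (by norm_num) z).hasDerivAt
  have hd' (z : ℝ) : HasDerivAt (deriv u) (deriv (deriv u) z) z :=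
    (hsmooth'.differentiable (by norm_num) z).hasDerivAt
  have hshift : ∫ z in (0:ℝ)..(2 * π), u (z + a) * deriv u z
      = ∫ z in (0:ℝ)..(2 * π), u z * deriv u (z - a) := by
    have hp : Function.Periodic (fun z => u z * deriv u (z - a)) (2 * π) := fun z => by
      simp only [hper z, show z + 2 * π - a = z - a + 2 * π by ring, hper' (z - a)]
    simpa using hp.intervalIntegral_comp_add a
  have hzero : ∫ z in (0:ℝ)..(2 * π), (lam ^ 2 * sin (z + u z) - lam * Γ * deriv u z ^ 2
      + lam ^ 2 * K * (u (z + a) * deriv u z - u z * deriv u (z - a))) = 0 := by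
    have hp : Function.Periodic (fun z => deriv u z ^ 2 / 2 - lam ^ 2 * cos (z + u z) - C * u z
        + lam ^ 2 * K * u z ^ 2 - lam ^ 2 * K * (u z * u (z - a))) (2 * π) := fun z => by
      simp only [hper z, hper' z, show z + 2 * π - a = z - a + 2 * π by ring, hper (z - a),
        show z + 2 * π + u z = z + u z + 2 * π by ring, cos_add_two_pi]
    refine hp.intervalIntegral_deriv_eq_zero (fun z => ?_) (by fun_prop)
    have hda : HasDerivAt (fun z => u (z - a)) (deriv u (z - a)) z :=
      (hd (z - a)).comp_sub_const z a
    refine HasDerivAt.congr_deriv ((((((hd' z).pow 2).div_const 2).sub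
      ((((hasDerivAt_id z).add (hd z)).cos).const_mul (lam ^ 2))).sub
      ((hd z).const_mul C)).add (((hd z).pow 2).const_mul (lam ^ 2 * K)) |>.sub
      (((hd z).mul hda).const_mul (lam ^ 2 * K))) ?_
    simp only [Pi.add_apply, id]
    push_cast
    linear_combination deriv u z * hode z
  rw [intervalIntegral.integral_add, intervalIntegral.integral_sub,
    intervalIntegral.integral_const_mul, intervalIntegral.integral_const_mul,
    intervalIntegral.integral_const_mul, intervalIntegral.integral_sub, hshift, sub_self,
    mul_zero, add_zero] at hzero
  · have h : Γ * ∫ s in (0:ℝ)..(2 * π), (deriv u s) ^ 2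
        = lam * ∫ s in (0:ℝ)..(2 * π), sin (s + u s) :=
      mul_left_cancel₀ hlam.ne' (by linear_combination -hzero)
    linear_combination (1 / (2 * π)) * h
  all_goals exact Continuous.intervalIntegrable (by fun_prop) _ _
end

section
/- Let λ > 0 and let u be a solution of equation (wff) with parameter λ. Then ‖u‖_Y ≤ λ/Γ, i.e., ((1/(2π)) ∫₀^{2π} u(s)² ds)^{1/2} ≤ λ/Γ. -/
open Real MeasureTheory Set in
/-- **Wirtinger's inequality** for `C¹` functions with zero mean taking equal values at the ends of
`[0, 2π]`. -/
theorem integral_sq_le_integral_deriv_sq {f f' : ℝ → ℝ} (hf : ∀ x, HasDerivAt f (f' x) x)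
    (hf' : Continuous f') (hper : f (2 * π) = f 0) (hmean : ∫ x in (0 : ℝ)..(2 * π), f x = 0) :
    ∫ x in (0 : ℝ)..(2 * π), f x ^ 2 ≤ ∫ x in (0 : ℝ)..(2 * π), f' x ^ 2 := by
  have hab : (0 : ℝ) < 2 * π := by positivity
  have hfc : Continuous f := continuous_iff_continuousAt.2 fun x => (hf x).continuousAt
  have memLp (g : ℝ → ℝ) (hg : Continuous g) :
      MemLp (fun x => (g x : ℂ)) 2 (volume.restrict (Ioc 0 (2 * π))) :=
    have hgc : Continuous fun x => (g x : ℂ) := Complex.continuous_ofReal.comp hg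
    (memLp_two_iff_integrable_sq_norm hgc.aestronglyMeasurable).2
      ((hgc.norm.pow 2).intervalIntegrable 0 (2 * π)).1
  have key := hasSum_le (fun n => ?_) (hasSum_sq_fourierCoeffOn hab (memLp f hfc))
    (hasSum_sq_fourierCoeffOn hab (memLp f' hf'))
  · simp only [Complex.norm_real, Real.norm_eq_abs, sq_abs, smul_eq_mul] at key
    exact le_of_mul_le_mul_left key (by simpa using Real.pi_pos)
  · rcases eq_or_ne n 0 with rfl | hn
    · have : fourierCoeffOn hab (fun x => (f x : ℂ)) 0 = 0 := by
        rw [fourierCoeffOn_eq_integral]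
        simp [intervalIntegral.integral_ofReal, hmean]
      rw [this]
      simp
    · rw [fourierCoeffOn_of_hasDerivAt hab hn (fun x _ => (hf x).ofReal_comp)
        ((Complex.continuous_ofReal.comp hf').intervalIntegrable _ _)]
      simp only [hper, sub_self, mul_zero, zero_sub]
      have hn1 : (1 : ℝ) ≤ |(n : ℝ)| := by exact_mod_cast Int.one_le_abs hn
      have hpi := Real.pi_pos
      gcongr
      set c := fourierCoeffOn hab (fun x => (f' x : ℂ)) n
      have : ‖1 / (-2 * (π : ℂ) * Complex.I * n) * -((((2 * π : ℝ) : ℂ) - ((0 : ℝ) : ℂ)) * c)‖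
          = ‖c‖ / |(n : ℝ)| := by
        simp [abs_of_pos hpi]
        field_simp
      rw [this]
      exact div_le_self (norm_nonneg c) hn1

open Real in
/-- Testing (wff) against `u'` bounds the `L²` norm of `u'`. -/
theorem WffSolution.integral_deriv_sq_le {n m : ℕ} {Γ K lam : ℝ} {u : ℝ → ℝ}
    (hu : WffSolution n m Γ K lam u) (hΓ : 0 < Γ) (hlam : 0 < lam) :
    ∫ z in (0 : ℝ)..(2 * π), deriv u z ^ 2 ≤ 2 * π * (lam / Γ) ^ 2 := by
  obtain ⟨hC, hper, -, heq⟩ := hu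
  have hu1 : ∀ z, HasDerivAt u (deriv u z) z := fun z =>
    (hC.differentiable (by norm_num) z).hasDerivAt
  have hCv : ContDiff ℝ 1 (deriv u) := by
    have h : ContDiff ℝ (1 + 1) u := by simpa [one_add_one_eq_two] using hC
    exact (contDiff_succ_iff_deriv.1 h).2.2
  have hv1 : ∀ z, HasDerivAt (deriv u) (deriv (deriv u) z) z := fun z =>
    (hCv.differentiable (by norm_num) z).hasDerivAt
  have huc : Continuous u := hC.continuous
  have hvc : Continuous (deriv u) := hCv.continuous
  have hwc : Continuous (deriv (deriv u)) := hCv.continuous_deriv (by norm_num)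
  have hvper : ∀ z, deriv u (z + 2 * π) = deriv u z := fun z => by
    rw [← deriv_comp_add_const, funext hper]
  set C := lam ^ 2 * (1 / (2 * π)) * ∫ s in (0 : ℝ)..(2 * π), Real.sin (s + u s)
  set a := 2 * π * m / n
  set v := deriv u
  set w := deriv v
  have exact_part : ∫ z in (0 : ℝ)..(2 * π), (v z * w z - C * v z + 2 * lam ^ 2 * K * (u z * v z)
      - lam ^ 2 * K * (v (z + a) * u z + u (z + a) * v z)) = 0 := by
    rw [intervalIntegral.integral_eq_sub_of_hasDerivAt
      (f := fun z => v z ^ 2 / 2 - C * u z + lam ^ 2 * K * u z ^ 2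
        - lam ^ 2 * K * (u (z + a) * u z))]
    · have h1 := hper 0
      have h2 := hvper 0
      have h3 := hper a
      rw [zero_add] at h1 h2
      rw [add_comm] at h3
      simp only [h1, h2, h3, zero_add, sub_self]
    · intro z _
      have h := (((((hv1 z).pow 2).div_const 2).sub ((hu1 z).const_mul C)).add
        (((hu1 z).pow 2).const_mul (lam ^ 2 * K))).sub
        ((((hu1 (z + a)).comp_add_const z a).mul (hu1 z)).const_mul (lam ^ 2 * K))
      refine h.congr_deriv ?_
      push_cast
      ring
    · exact Continuous.intervalIntegrable (by fun_prop) _ _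
  have shift_part : ∫ z in (0 : ℝ)..(2 * π), (v (z + a) * u z - v z * u (z - a)) = 0 := by
    rw [intervalIntegral.integral_sub (Continuous.intervalIntegrable (by fun_prop) _ _)
      (Continuous.intervalIntegrable (by fun_prop) _ _)]
    have hg : Function.Periodic (fun z => v z * u (z - a)) (2 * π) := fun z => by
      simp only [hvper, add_sub_right_comm, hper]
    have h := intervalIntegral.integral_comp_add_right (a := 0) (b := 2 * π)
      (fun z => v z * u (z - a)) a
    simp only [add_sub_cancel_right] at h
    rw [h, zero_add, add_comm (2 * π) a, hg.intervalIntegral_add_eq a 0, zero_add, sub_self]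
  have pointwise : ∀ z, (v z * w z - C * v z + 2 * lam ^ 2 * K * (u z * v z)
      - lam ^ 2 * K * (v (z + a) * u z + u (z + a) * v z))
      + lam ^ 2 * K * (v (z + a) * u z - v z * u (z - a)) + lam * Γ / 2 * v z ^ 2
      ≤ lam ^ 3 / (2 * Γ) := by
    intro z
    have hs : Real.sin (z + u z) ^ 2 ≤ 1 := Real.sin_sq_le_one _
    have hsq : 0 ≤ lam / (2 * Γ) * (Γ * v z + lam * Real.sin (z + u z)) ^ 2 := by positivity
    have hb : lam ^ 3 / (2 * Γ) * Real.sin (z + u z) ^ 2 ≤ lam ^ 3 / (2 * Γ) :=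
      mul_le_of_le_one_right (by positivity) hs
    have expand : lam / (2 * Γ) * (Γ * v z + lam * Real.sin (z + u z)) ^ 2
        = lam * Γ / 2 * v z ^ 2 + lam ^ 2 * Real.sin (z + u z) * v z
          + lam ^ 3 / (2 * Γ) * Real.sin (z + u z) ^ 2 := by
      field_simp
      ring
    linear_combination hb + hsq + expand + v z * heq z
  have hint := intervalIntegral.integral_mono_on (μ := MeasureTheory.volume)
    (a := 0) (b := 2 * π) (by positivity)
    (Continuous.intervalIntegrable (by fun_prop) _ _)
    (Continuous.intervalIntegrable continuous_const _ _) (fun z _ => pointwise z)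
  rw [intervalIntegral.integral_add (Continuous.intervalIntegrable (by fun_prop) _ _)
      (Continuous.intervalIntegrable (by fun_prop) _ _),
    intervalIntegral.integral_add (Continuous.intervalIntegrable (by fun_prop) _ _)
      (Continuous.intervalIntegrable (by fun_prop) _ _),
    exact_part, intervalIntegral.integral_const_mul, shift_part,
    intervalIntegral.integral_const_mul, intervalIntegral.integral_const] at hint
  simp only [mul_zero, zero_add, sub_zero, smul_eq_mul] at hint
  have hpos : 0 < lam * Γ / 2 := by positivity
  refine le_of_mul_le_mul_left (hint.trans_eq ?_) hpos
  field_simp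


open Real in
/-- Any solution `u` of (wff) with parameter `λ > 0` satisfies `‖u‖_Y ≤ λ/Γ`. -/
theorem norm_le_of_wffSolution (n m : ℕ) (hn : 1 ≤ n) (hm : 1 ≤ m)
    (Γ K lam : ℝ) (hΓ : 0 < Γ) (hK : 0 < K) (hlam : 0 < lam)
    (u : ℝ → ℝ) (hu : WffSolution n m Γ K lam u) :
    Real.sqrt ((1 / (2 * π)) * ∫ s in (0:ℝ)..(2 * π), (u s) ^ 2) ≤ lam / Γ := by
  have hbound := hu.integral_deriv_sq_le hΓ hlam
  obtain ⟨hC, hper, hmean, -⟩ := hu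
  have hwirt := integral_sq_le_integral_deriv_sq
    (fun x => (hC.differentiable (by norm_num) x).hasDerivAt)
    (hC.continuous_deriv (by norm_num)) (by simpa using hper 0) hmean
  rw [Real.sqrt_le_left (by positivity), one_div, inv_mul_le_iff₀ (by positivity)]
  exact hwirt.trans hbound
end
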